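/- For every even integer q ≥ 2, the Chord-Cavity-Generator H satisfies H(z,x) = Σ_{v≥1} (z^v/v!) Σ_{T ∈ 𝒯_v} Σ_{r ∈ V(T)} b_{T,r}(x) for all z with |z| ≤ e⁻² and all x ∈ Ω, where the inner double sum is taken to be 0 when 𝒯_v is empty. -/

import Mathlib

open MeasureTheory Filter

noncomputable section

namespace SYK

attribute [local instance] Classical.propDecidable

/-- The chord crossing sign `K(x,y)`. -/
def K (x y : ℝ × ℝ) : ℝ :=
  if (x.1 < y.1 ∧ y.1 < x.2 ∧ x.2 < y.2) ∨ (y.1 < x.1 ∧ x.1 < y.2 ∧ y.2 < x.2) then -1 else 1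

lemma K_symm (x y : ℝ × ℝ) : K x y = K y x := if_congr or_comm rfl rfl

/-- The law of `(min U₁ U₂, max U₁ U₂)` for `U₁, U₂` i.i.d. uniform on `[0,1]`. -/
def nu : Measure (ℝ × ℝ) :=
  Measure.map (fun p : ℝ × ℝ => (min p.1 p.2, max p.1 p.2))
    (volume.restrict (Set.Icc (0 : ℝ) 1 ×ˢ Set.Icc (0 : ℝ) 1))

/-- `Ω = [0,1]²`. -/
def Omega : Set (ℝ × ℝ) := Set.Icc (0 : ℝ) 1 ×ˢ Set.Icc (0 : ℝ) 1

/-- The closed disk `{z : |z| ≤ e⁻²}`. -/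
def De : Set ℂ := Metric.closedBall 0 (Real.exp (-2))

/-- Membership in `ℱ_{e,Ω}`: continuous on the domain and bounded by `1` there. -/
def memF (G : ℂ → ℝ × ℝ → ℂ) : Prop :=
  ContinuousOn (fun p : ℂ × (ℝ × ℝ) => G p.1 p.2) (De ×ˢ Omega) ∧
    ∀ z ∈ De, ∀ x ∈ Omega, ‖G z x‖ ≤ 1

/-- `∏_{1 ≤ i < j ≤ d} K(y_i, y_j)`. -/
def pairProd (d : ℕ) (y : Fin d → ℝ × ℝ) : ℝ :=
  ∏ p ∈ Finset.univ.filter (fun p : Fin d × Fin d => p.1 < p.2), K (y p.1) (y p.2)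

/-- The `d`-th term of the series defining the operator `𝒯`. -/
def Tterm (q : ℕ) (G : ℂ → ℝ × ℝ → ℂ) (z : ℂ) (x : ℝ × ℝ) (d : ℕ) : ℂ :=
  ((d.factorial : ℂ))⁻¹ *
    ∫ y : Fin d → ℝ × ℝ,
      (∏ i, ((K x (y i) : ℂ) * (G z (y i)) ^ (q - 1) / ((q - 1).factorial : ℂ))) *
        (pairProd d y : ℂ) ∂(Measure.pi fun _ => nu)

/-- The operator `𝒯` (Chord-Cavity operator). -/
def Tcal (q : ℕ) (G : ℂ → ℝ × ℝ → ℂ) (z : ℂ) (x : ℝ × ℝ) : ℂ :=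
  z + z * ∑' d : ℕ, Tterm q G z x (d + 1)

/-- `H` is a Chord-Cavity-Generator: it lies in `ℱ_{e,Ω}` and satisfies the
fixed point equation on the domain. -/
def IsCCG (q : ℕ) (H : ℂ → ℝ × ℝ → ℂ) : Prop :=
  memF H ∧ ∀ z ∈ De, ∀ x ∈ Omega, H z x = Tcal q H z x

/-- Two vertices are related if some hyperedge of `E` contains both. -/
def edgeRel {N : ℕ} (E : Finset (Finset (Fin N))) (a b : Fin N) : Prop :=
  ∃ e ∈ E, a ∈ e ∧ b ∈ e

/-- A hypergraph on the full vertex set `Fin N` is connected. -/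
def HGConnected {N : ℕ} (E : Finset (Finset (Fin N))) : Prop :=
  ∀ a b : Fin N, Relation.ReflTransGen (edgeRel E) a b

/-- `E` is a `q`-uniform hypertree on the vertex set `Fin N`. -/
def IsHypertree (q N : ℕ) (E : Finset (Finset (Fin N))) : Prop :=
  (∀ e ∈ E, e.card = q) ∧ HGConnected E ∧ (q - 1) * E.card = N - 1

/-- The set `𝒯_N` of `q`-uniform hypertrees on `{1,…,N}`. -/
def trees (q N : ℕ) : Finset (Finset (Finset (Fin N))) :=
  Finset.univ.filter (IsHypertree q N)

/-- Sign contributed by an unordered pair of hyperedges with chords given by `X`. -/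
def pairSign {N : ℕ} (X : Finset (Fin N) → ℝ × ℝ) : Sym2 (Finset (Fin N)) → ℝ :=
  Sym2.lift ⟨fun e₁ e₂ => if Odd (e₁ ∩ e₂).card then K (X e₁) (X e₂) else 1,
    fun e₁ e₂ => if_congr (by rw [Finset.inter_comm]) (K_symm _ _) rfl⟩

/-- `B_H(X)`: the product of `K(X(e₁),X(e₂))` over unordered pairs of distinct
hyperedges sharing an odd number of vertices. -/
def BE {N : ℕ} (E : Finset (Finset (Fin N))) (X : Finset (Fin N) → ℝ × ℝ) : ℝ :=
  ∏ p ∈ E.sym2.filter (fun p => ¬ p.IsDiag), pairSign X p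

/-- `b_H`: the expectation of `B_H(X)` over i.i.d. chords with law `ν`. -/
def bT {N : ℕ} (E : Finset (Finset (Fin N))) : ℝ :=
  ∫ X : Finset (Fin N) → ℝ × ℝ, BE E X ∂(Measure.pi fun _ => nu)

/-- `b_{H,r}(x)` for a rooted hypergraph: the chord of the virtual root edge is fixed at `x`. -/
def bTr {N : ℕ} (E : Finset (Finset (Fin N))) (r : Fin N) (x : ℝ × ℝ) : ℝ :=
  ∫ X : Finset (Fin N) → ℝ × ℝ,
    (∏ e ∈ E.filter (fun e => r ∈ e), K x (X e)) * BE E X ∂(Measure.pi fun _ => nu)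

/-- A set that is reachable from `R` along `s + 1`-uniform hyperedges has at most
`|R| + s |E|` elements. -/
lemma card_le_of_reachable {N s : ℕ} (E : Finset (Finset (Fin N)))
    (hE : ∀ e ∈ E, e.card = s + 1) (R U : Finset (Fin N))
    (h : ∀ u ∈ U, ∃ r ∈ R, Relation.ReflTransGen (edgeRel E) r u) :
    U.card ≤ R.card + s * E.card := by
  induction E using Finset.induction_on generalizing R with
  | empty =>
    have hsub : U ⊆ R := by
      intro u hu
      obtain ⟨r, hr, hru⟩ := h u hu
      rcases Relation.ReflTransGen.cases_tail hru with h1 | ⟨c, -, e, he, -⟩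
      · exact h1 ▸ hr
      · simp at he
    simpa using Finset.card_le_card hsub
  | insert e E he ih =>
    have hE' : ∀ f ∈ E, f.card = s + 1 := fun f hf => hE f (Finset.mem_insert_of_mem hf)
    rw [Finset.card_insert_of_notMem he]
    by_cases hv : ∃ v ∈ e, ∃ r ∈ R, Relation.ReflTransGen (edgeRel E) r v
    · obtain ⟨v, hve, r₀, hr₀, hr₀v⟩ := hv
      have key : U.card ≤ (R ∪ e.erase v).card + s * E.card := by
        refine ih hE' _ fun u hu => ?_
        obtain ⟨r, hr, hru⟩ := h u hu
        clear hu
        induction hru with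
        | refl => exact ⟨r, Finset.mem_union_left _ hr, .refl⟩
        | @tail b c _ hbc ihb =>
          obtain ⟨f, hf, hbf, hcf⟩ := hbc
          rcases Finset.mem_insert.1 hf with rfl | hf
          · by_cases hcv : c = v
            · exact ⟨r₀, Finset.mem_union_left _ hr₀, hcv ▸ hr₀v⟩
            · exact ⟨c, Finset.mem_union_right _ (Finset.mem_erase.2 ⟨hcv, hcf⟩), .refl⟩
          · obtain ⟨r', hr', hr'b⟩ := ihb
            exact ⟨r', hr', hr'b.tail ⟨f, hf, hbf, hcf⟩⟩
      have h1 := Finset.card_union_le R (e.erase v)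
      have h2 : (e.erase v).card = s := by
        rw [Finset.card_erase_of_mem hve, hE e (Finset.mem_insert_self _ _)]; rfl
      rw [mul_add]
      omega
    · push Not at hv
      have key : U.card ≤ R.card + s * E.card := by
        refine ih hE' _ fun u hu => ?_
        obtain ⟨r, hr, hru⟩ := h u hu
        refine ⟨r, hr, ?_⟩
        clear hu
        induction hru with
        | refl => exact .refl
        | @tail b c _ hbc ihb =>
          obtain ⟨f, hf, hbf, hcf⟩ := hbc
          rcases Finset.mem_insert.1 hf with rfl | hf
          · exact absurd ihb (hv b hbf r hr)
          · exact ihb.tail ⟨f, hf, hbf, hcf⟩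
      rw [mul_add]
      omega

/-- The `s + 1`-uniform hypertrees whose vertex set is `S`. -/
def treesOn {N : ℕ} (s : ℕ) (S : Finset (Fin N)) : Finset (Finset (Finset (Fin N))) :=
  Finset.univ.filter fun E => (∀ e ∈ E, e.card = s + 1 ∧ e ⊆ S) ∧
    (∀ a ∈ S, ∀ b ∈ S, Relation.ReflTransGen (edgeRel E) a b) ∧ s * E.card + 1 = S.card

lemma mem_treesOn {N s : ℕ} {S : Finset (Fin N)} {E : Finset (Finset (Fin N))} :
    E ∈ treesOn s S ↔ (∀ e ∈ E, e.card = s + 1 ∧ e ⊆ S) ∧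
    (∀ a ∈ S, ∀ b ∈ S, Relation.ReflTransGen (edgeRel E) a b) ∧ s * E.card + 1 = S.card := by
  simp [treesOn]

lemma trees_eq_treesOn (s n : ℕ) :
    trees (s + 1) (n + 1) = treesOn s (Finset.univ : Finset (Fin (n + 1))) := by
  ext E
  simp [trees, treesOn, IsHypertree, HGConnected]

lemma edgeRel_mono {N : ℕ} {E F : Finset (Finset (Fin N))} (h : E ⊆ F) {a b : Fin N}
    (hab : Relation.ReflTransGen (edgeRel E) a b) : Relation.ReflTransGen (edgeRel F) a b :=
  hab.lift id fun _ _ ⟨e, he, h1, h2⟩ => ⟨e, h he, h1, h2⟩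

lemma edgeRel_symm {N : ℕ} {E : Finset (Finset (Fin N))} {a b : Fin N}
    (hab : Relation.ReflTransGen (edgeRel E) a b) : Relation.ReflTransGen (edgeRel E) b a :=
  have : Std.Symm (edgeRel E) := ⟨fun _ _ ⟨e, he, h1, h2⟩ => ⟨e, he, h2, h1⟩⟩
  Relation.ReflTransGen.stdSymm.symm _ _ hab

/-- The `i`-th hyperedge at the root `r`, whose other vertices are the `ρ (i, j)`. -/
def starEdge {N d s : ℕ} (r : Fin N) (ρ : Fin d × Fin s → Fin N) (i : Fin d) :
    Finset (Fin N) :=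
  insert r (Finset.univ.image fun j => ρ (i, j))

/-- The forest below the root hyperedges. -/
def forest {N d s : ℕ} (p : Fin d × Fin s → Fin N × Finset (Finset (Fin N))) :
    Finset (Finset (Fin N)) :=
  Finset.univ.biUnion fun k => (p k).2

/-- The hypergraph obtained by attaching rooted hypergraphs to a root `r` by `d` hyperedges. -/
def glue {N d s : ℕ} (r : Fin N) (p : Fin d × Fin s → Fin N × Finset (Finset (Fin N))) :
    Finset (Finset (Fin N)) :=
  Finset.univ.image (starEdge r fun k => (p k).1) ∪ forest p

/-- The rooted hypergraphs `p k` are hypertrees whose vertex sets `S k` partition the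
vertices other than `r`. -/
structure IsPieces {N d s : ℕ} (r : Fin N) (S : Fin d × Fin s → Finset (Fin N))
    (p : Fin d × Fin s → Fin N × Finset (Finset (Fin N))) : Prop where
  root_notMem : ∀ k, r ∉ S k
  eq_of_mem : ∀ k k' v, v ∈ S k → v ∈ S k' → k = k'
  exists_mem : ∀ v, v ≠ r → ∃ k, v ∈ S k
  mem : ∀ k, (p k).1 ∈ S k
  tree : ∀ k, (p k).2 ∈ treesOn s (S k)

lemma sum_card_of_partition {N d s : ℕ} {r : Fin N} {S : Fin d × Fin s → Finset (Fin N)}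
    (h1 : ∀ k, r ∉ S k) (h2 : ∀ k k' v, v ∈ S k → v ∈ S k' → k = k')
    (h3 : ∀ v, v ≠ r → ∃ k, v ∈ S k) : ∑ k, (S k).card + 1 = N := by
  rw [← Finset.card_biUnion]
  · have : Finset.univ.biUnion S = Finset.univ.erase r := by
      ext v
      simp only [Finset.mem_biUnion, Finset.mem_univ, true_and, Finset.mem_erase, and_true]
      exact ⟨fun ⟨k, hk⟩ hv => h1 k (hv ▸ hk), h3 v⟩
    rw [this, Finset.card_erase_add_one (Finset.mem_univ _), Finset.card_univ, Fintype.card_fin]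
  · intro k _ k' _ hkk'
    exact Finset.disjoint_left.2 fun v hv hv' => hkk' (h2 k k' v hv hv')

namespace IsPieces

variable {N d s : ℕ} {r : Fin N} {S : Fin d × Fin s → Finset (Fin N)}
  {p : Fin d × Fin s → Fin N × Finset (Finset (Fin N))}

lemma root_injective (h : IsPieces r S p) : Function.Injective fun k => (p k).1 :=
  fun k k' hkk' => h.eq_of_mem k k' _ (h.mem k) (by simpa [hkk'] using h.mem k')

lemma root_ne (h : IsPieces r S p) (k) : (p k).1 ≠ r :=
  fun hk => h.root_notMem k (hk ▸ h.mem k)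

lemma card_starEdge (h : IsPieces r S p) (i : Fin d) :
    (starEdge r (fun k => (p k).1) i).card = s + 1 := by
  rw [starEdge, Finset.card_insert_of_notMem, Finset.card_image_of_injective]
  · simp
  · intro j j' hj
    simpa using h.root_injective hj
  · simp only [Finset.mem_image, Finset.mem_univ, true_and, not_exists]
    exact fun j => h.root_ne (i, j)

lemma mem_starEdge_iff (h : IsPieces r S p) {i : Fin d} {k} {v : Fin N} (hv : v ∈ S k) :
    v ∈ starEdge r (fun k => (p k).1) i ↔ k.1 = i ∧ v = (p k).1 := by
  have hvr : v ≠ r := fun hh => h.root_notMem k (hh ▸ hv)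
  simp only [starEdge, Finset.mem_insert, hvr, Finset.mem_image, Finset.mem_univ, true_and,
    false_or]
  constructor
  · rintro ⟨j, rfl⟩
    have := h.eq_of_mem _ _ _ hv (h.mem (i, j))
    subst this
    exact ⟨rfl, rfl⟩
  · rintro ⟨rfl, rfl⟩
    exact ⟨k.2, rfl⟩

lemma starEdge_injective (h : IsPieces r S p) (hs : 1 ≤ s) :
    Function.Injective (starEdge r fun k => (p k).1) := by
  intro i i' hii'
  have h1 := (h.mem_starEdge_iff (i := i) (h.mem (i, ⟨0, hs⟩))).2 ⟨rfl, rfl⟩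
  rw [hii', h.mem_starEdge_iff (h.mem (i, ⟨0, hs⟩))] at h1
  exact h1.1

lemma root_notMem_edge (h : IsPieces r S p) {k} {e : Finset (Fin N)} (he : e ∈ (p k).2) :
    r ∉ e :=
  fun hr => h.root_notMem k (((mem_treesOn.1 (h.tree k)).1 e he).2 hr)

lemma edge_subset (h : IsPieces r S p) {k} {e : Finset (Fin N)} (he : e ∈ (p k).2) :
    e ⊆ S k := ((mem_treesOn.1 (h.tree k)).1 e he).2

lemma eq_of_edge (h : IsPieces r S p) {k k'} {e : Finset (Fin N)} (he : e ∈ (p k).2)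
    (he' : e ⊆ S k') : k = k' := by
  have hc := ((mem_treesOn.1 (h.tree k)).1 e he).1
  obtain ⟨v, hv⟩ : e.Nonempty := Finset.card_pos.1 (by omega)
  exact h.eq_of_mem k k' v (h.edge_subset he hv) (he' hv)

lemma starEdge_notMem_forest (h : IsPieces r S p) (i : Fin d) (k) :
    starEdge r (fun k => (p k).1) i ∉ (p k).2 :=
  fun hi => h.root_notMem_edge hi (Finset.mem_insert_self _ _)

lemma filter_root_mem (h : IsPieces r S p) :
    (glue r p).filter (fun e => r ∈ e) = Finset.univ.image (starEdge r fun k => (p k).1) := by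
  ext e
  simp only [glue, forest, Finset.mem_filter, Finset.mem_union, Finset.mem_biUnion,
    Finset.mem_univ, true_and, Finset.mem_image]
  constructor
  · rintro ⟨h1 | ⟨k, hk⟩, hr⟩
    · exact h1
    · exact absurd hr (h.root_notMem_edge hk)
  · rintro ⟨i, rfl⟩
    exact ⟨Or.inl ⟨i, rfl⟩, Finset.mem_insert_self _ _⟩

lemma filter_root_notMem (h : IsPieces r S p) :
    (glue r p).filter (fun e => r ∉ e) = forest p := by
  ext e
  simp only [glue, forest, Finset.mem_filter, Finset.mem_union, Finset.mem_biUnion,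
    Finset.mem_univ, true_and, Finset.mem_image]
  constructor
  · rintro ⟨⟨i, rfl⟩ | h1, hr⟩
    · exact absurd (Finset.mem_insert_self _ _) hr
    · exact h1
  · rintro ⟨k, hk⟩
    exact ⟨Or.inr ⟨k, hk⟩, h.root_notMem_edge hk⟩

lemma mem_iff_reachable (h : IsPieces r S p) (k) (v : Fin N) :
    v ∈ S k ↔ Relation.ReflTransGen (edgeRel (forest p)) (p k).1 v := by
  constructor
  · intro hv
    exact edgeRel_mono (Finset.subset_biUnion_of_mem (fun k => (p k).2) (Finset.mem_univ k))
      ((mem_treesOn.1 (h.tree k)).2.1 _ (h.mem k) _ hv)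
  · intro hv
    induction hv with
    | refl => exact h.mem k
    | tail _ hbc ih =>
      obtain ⟨e, he, hb, hc⟩ := hbc
      obtain ⟨k', -, hk'⟩ := Finset.mem_biUnion.1 he
      have := h.eq_of_mem _ _ _ ih (h.edge_subset hk' hb)
      subst this
      exact h.edge_subset hk' hc

lemma piece_eq_filter (h : IsPieces r S p) (k) :
    (p k).2 = (forest p).filter (fun e => e ⊆ S k) := by
  ext e
  simp only [forest, Finset.mem_filter, Finset.mem_biUnion, Finset.mem_univ, true_and]
  constructor
  · intro he
    exact ⟨⟨k, he⟩, h.edge_subset he⟩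
  · rintro ⟨⟨k', hk'⟩, hs⟩
    exact h.eq_of_edge hk' hs ▸ hk'

lemma card_forest (h : IsPieces r S p) : (forest p).card = ∑ k, (p k).2.card := by
  refine Finset.card_biUnion fun k _ k' _ hkk' => Finset.disjoint_left.2 fun e he he' => ?_
  exact hkk' (h.eq_of_edge he (h.edge_subset he'))

lemma disjoint_star_forest (h : IsPieces r S p) :
    Disjoint (Finset.univ.image (starEdge r fun k => (p k).1)) (forest p) := by
  refine Finset.disjoint_left.2 fun e he he' => ?_
  obtain ⟨i, -, rfl⟩ := Finset.mem_image.1 he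
  obtain ⟨k, -, hk⟩ := Finset.mem_biUnion.1 he'
  exact h.starEdge_notMem_forest i k hk

lemma glue_mem_treesOn (h : IsPieces r S p) (hs : 1 ≤ s) :
    glue r p ∈ treesOn s (Finset.univ : Finset (Fin N)) := by
  refine mem_treesOn.2 ⟨fun e he => ⟨?_, Finset.subset_univ _⟩, ?_, ?_⟩
  · rcases Finset.mem_union.1 he with he | he
    · obtain ⟨i, -, rfl⟩ := Finset.mem_image.1 he
      exact h.card_starEdge i
    · obtain ⟨k, -, hk⟩ := Finset.mem_biUnion.1 he
      exact ((mem_treesOn.1 (h.tree k)).1 e hk).1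
  · have key : ∀ v, Relation.ReflTransGen (edgeRel (glue r p)) r v := by
      intro v
      by_cases hv : v = r
      · exact hv ▸ .refl
      obtain ⟨k, hk⟩ := h.exists_mem v hv
      refine Relation.ReflTransGen.head (b := (p k).1) ?_
        (edgeRel_mono Finset.subset_union_right ((h.mem_iff_reachable k v).1 hk))
      refine ⟨starEdge r (fun k => (p k).1) k.1, Finset.mem_union_left _
        (Finset.mem_image_of_mem _ (Finset.mem_univ _)), Finset.mem_insert_self _ _, ?_⟩
      exact (h.mem_starEdge_iff (h.mem k)).2 ⟨rfl, rfl⟩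
    exact fun a _ b _ => (edgeRel_symm (key a)).trans (key b)
  · rw [glue, Finset.card_union_of_disjoint h.disjoint_star_forest, h.card_forest,
      Finset.card_image_of_injective _ (h.starEdge_injective hs), Finset.card_univ,
      Fintype.card_fin, Finset.card_univ, Fintype.card_fin]
    have h1 := sum_card_of_partition h.root_notMem h.eq_of_mem h.exists_mem
    have h2 : ∀ k, (S k).card = s * (p k).2.card + 1 := fun k =>
      (mem_treesOn.1 (h.tree k)).2.2.symm
    simp only [h2, Finset.sum_add_distrib, ← Finset.mul_sum, Finset.sum_const, Finset.card_univ,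
      Fintype.card_prod, Fintype.card_fin, smul_eq_mul, mul_one] at h1
    rw [mul_add, mul_comm s d]
    omega

end IsPieces

/-- `ρ` enumerates the hyperedges of `E` at `r` and their vertices other than `r`. -/
def EnumStar {N d s : ℕ} (r : Fin N) (E : Finset (Finset (Fin N)))
    (ρ : Fin d × Fin s → Fin N) : Prop :=
  Finset.univ.image (starEdge r ρ) = E.filter (fun e => r ∈ e) ∧
    Function.Injective (starEdge r ρ)

lemma IsPieces.enumStar {N d s : ℕ} {r : Fin N} {S : Fin d × Fin s → Finset (Fin N)}
    {p : Fin d × Fin s → Fin N × Finset (Finset (Fin N))} (h : IsPieces r S p) (hs : 1 ≤ s) :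
    EnumStar r (glue r p) fun k => (p k).1 :=
  ⟨h.filter_root_mem.symm, h.starEdge_injective hs⟩

lemma exists_isPieces {N d s : ℕ} (r : Fin N) (E : Finset (Finset (Fin N)))
    (hE : E ∈ treesOn s (Finset.univ : Finset (Fin N)))
    (ρ : Fin d × Fin s → Fin N) (hρ : EnumStar r E ρ) :
    ∃ S p, IsPieces r S p ∧ glue r p = E ∧ ∀ k, (p k).1 = ρ k := by
  obtain ⟨hcard, hconn, hcount⟩ := mem_treesOn.1 hE
  have hNr : (Finset.univ.image (starEdge r ρ)).card = d := by
    rw [Finset.card_image_of_injective _ hρ.2, Finset.card_univ, Fintype.card_fin]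
  set F := E.filter (fun e => r ∉ e) with hF
  have hFcard : E.card = d + F.card := by
    rw [← hNr, hρ.1, hF, Finset.card_filter_add_card_filter_not]
  have hFu : ∀ e ∈ F, e.card = s + 1 := fun e he => (hcard e (Finset.mem_filter.1 he).1).1
  have hstarcard : ∀ i, (starEdge r ρ i).card = s + 1 := by
    intro i
    have : starEdge r ρ i ∈ E.filter (fun e => r ∈ e) :=
      hρ.1 ▸ Finset.mem_image_of_mem _ (Finset.mem_univ i)
    exact (hcard _ (Finset.mem_filter.1 this).1).1
  have hρr : ∀ k, ρ k ≠ r := by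
    rintro ⟨i, j⟩ hk
    have h1 := hstarcard i
    have h2 : r ∈ Finset.univ.image fun j => ρ (i, j) := by
      rw [← hk]; exact Finset.mem_image_of_mem (fun j => ρ (i, j)) (Finset.mem_univ j)
    rw [starEdge, Finset.insert_eq_of_mem h2] at h1
    have h3 : (Finset.univ.image fun j => ρ (i, j)).card ≤ s := by
      simpa using Finset.card_image_le (s := Finset.univ) (f := fun j => ρ (i, j))
    omega
  have hreach : ∀ v, v ≠ r → ∃ k, Relation.ReflTransGen (edgeRel F) (ρ k) v := by
    intro v
    have := hconn r (Finset.mem_univ _) v (Finset.mem_univ _)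
    induction this with
    | refl => exact fun h => absurd rfl h
    | @tail b c _ hbc ih =>
      intro hc
      obtain ⟨e, he, hbe, hce⟩ := hbc
      by_cases hre : r ∈ e
      · have h1 : e ∈ Finset.univ.image (starEdge r ρ) := by
          rw [hρ.1]; exact Finset.mem_filter.2 ⟨he, hre⟩
        obtain ⟨i, -, rfl⟩ := Finset.mem_image.1 h1
        rcases Finset.mem_insert.1 hce with h2 | h2
        · exact absurd h2 hc
        · obtain ⟨j, -, rfl⟩ := Finset.mem_image.1 h2
          exact ⟨(i, j), .refl⟩
      · obtain ⟨k, hk⟩ := ih (fun hb => hre (hb ▸ hbe))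
        exact ⟨k, hk.tail ⟨e, Finset.mem_filter.2 ⟨he, hre⟩, hbe, hce⟩⟩
  have hdisj : ∀ k k' v, Relation.ReflTransGen (edgeRel F) (ρ k) v →
      Relation.ReflTransGen (edgeRel F) (ρ k') v → k = k' := by
    intro k k' v hk hk'
    by_contra hne
    have h1 := card_le_of_reachable F hFu ((Finset.univ.erase k').image ρ)
      (Finset.univ.erase r) (by
        intro u hu
        obtain ⟨l, hl⟩ := hreach u (Finset.ne_of_mem_erase hu)
        by_cases hlk : l = k'
        · subst hlk
          exact ⟨ρ k, Finset.mem_image_of_mem _ (by simpa using hne),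
            (hk.trans (edgeRel_symm hk')).trans hl⟩
        · exact ⟨ρ l, Finset.mem_image_of_mem _ (by simpa using hlk), hl⟩)
    have h2 : ((Finset.univ.erase k').image ρ).card ≤ d * s - 1 := by
      refine Finset.card_image_le.trans ?_
      rw [Finset.card_erase_of_mem (Finset.mem_univ _)]
      simp
    have h3 : 0 < d * s := Nat.mul_pos k.1.pos k.2.pos
    rw [Finset.card_erase_of_mem (Finset.mem_univ _), ← hcount, hFcard, mul_add, mul_comm s d]
      at h1
    omega
  let S : Fin d × Fin s → Finset (Fin N) := fun k =>
    Finset.univ.filter fun v => Relation.ReflTransGen (edgeRel F) (ρ k) v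
  have hS : ∀ k v, v ∈ S k ↔ Relation.ReflTransGen (edgeRel F) (ρ k) v := by simp [S]
  have hrS : ∀ k, r ∉ S k := by
    intro k hk
    rcases Relation.ReflTransGen.cases_tail ((hS k r).1 hk) with h1 | ⟨c, -, e, he, -, hr⟩
    · exact hρr k h1.symm
    · exact (Finset.mem_filter.1 he).2 hr
  have hSd : ∀ k k' v, v ∈ S k → v ∈ S k' → k = k' := fun k k' v h1 h2 =>
    hdisj k k' v ((hS _ _).1 h1) ((hS _ _).1 h2)
  have hSe : ∀ v, v ≠ r → ∃ k, v ∈ S k := fun v hv =>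
    let ⟨k, hk⟩ := hreach v hv; ⟨k, (hS _ _).2 hk⟩
  let T : Fin d × Fin s → Finset (Finset (Fin N)) := fun k => F.filter fun e => e ⊆ S k
  have hTF : Finset.univ.biUnion T = F := by
    ext e
    simp only [T, Finset.mem_biUnion, Finset.mem_univ, true_and, Finset.mem_filter]
    refine ⟨fun ⟨_, h, _⟩ => h, fun he => ?_⟩
    obtain ⟨v, hv⟩ : e.Nonempty := Finset.card_pos.1 (by rw [hFu e he]; omega)
    obtain ⟨k, hk⟩ := hreach v (fun h => (Finset.mem_filter.1 he).2 (h ▸ hv))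
    exact ⟨k, he, fun w hw => (hS _ _).2 (hk.tail ⟨e, he, hv, hw⟩)⟩
  have hTd : F.card = ∑ k, (T k).card := by
    conv_lhs => rw [← hTF]
    refine Finset.card_biUnion fun k _ k' _ hkk' => Finset.disjoint_left.2 fun e he he' => ?_
    obtain ⟨he1, he2⟩ := Finset.mem_filter.1 he
    obtain ⟨v, hv⟩ : e.Nonempty := Finset.card_pos.1 (by rw [hFu e he1]; omega)
    exact hkk' (hSd k k' v (he2 hv) ((Finset.mem_filter.1 he').2 hv))
  have hreachT : ∀ k v, v ∈ S k → Relation.ReflTransGen (edgeRel (T k)) (ρ k) v := by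
    intro k v hv
    have := (hS k v).1 hv
    induction this with
    | refl => exact .refl
    | @tail b c hb hbc ih =>
      obtain ⟨e, he, hbe, hce⟩ := hbc
      refine (ih ((hS _ _).2 hb)).tail ⟨e, Finset.mem_filter.2 ⟨he, fun w hw => ?_⟩, hbe, hce⟩
      exact (hS _ _).2 (hb.tail ⟨e, he, hbe, hw⟩)
  have hle : ∀ k ∈ Finset.univ, (S k).card ≤ 1 + s * (T k).card := by
    intro k _
    have := card_le_of_reachable (T k) (fun e he => hFu e (Finset.mem_filter.1 he).1) {ρ k}
      (S k) fun v hv => ⟨ρ k, Finset.mem_singleton_self _, hreachT k v hv⟩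
    simpa using this
  have heq := (Finset.sum_eq_sum_iff_of_le hle).1 (by
    have h1 := sum_card_of_partition hrS hSd hSe
    simp only [Finset.sum_add_distrib, ← Finset.mul_sum, ← hTd, Finset.sum_const,
      Finset.card_univ, Fintype.card_prod, Fintype.card_fin, smul_eq_mul, mul_one] at h1 ⊢ hcount
    rw [hFcard, mul_add, mul_comm s d] at hcount
    omega)
  refine ⟨S, fun k => (ρ k, T k), ⟨hrS, hSd, hSe, fun k => (hS _ _).2 .refl, fun k => ?_⟩, ?_,
    fun k => rfl⟩
  · refine mem_treesOn.2 ⟨fun e he => ?_, fun a ha b hb => ?_, ?_⟩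
    · obtain ⟨h1, h2⟩ := Finset.mem_filter.1 he
      exact ⟨hFu e h1, h2⟩
    · exact (edgeRel_symm (hreachT k a ha)).trans (hreachT k b hb)
    · rw [heq k (Finset.mem_univ _), add_comm]
  · change Finset.univ.image (starEdge r ρ) ∪ Finset.univ.biUnion T = E
    rw [hTF, hρ.1, hF, Finset.filter_union_filter_not_eq]

/-- The block of vertices with colour `k`. -/
def block {N d s : ℕ} (r : Fin N) (c : {v : Fin N // v ≠ r} → Fin d × Fin s)
    (k : Fin d × Fin s) : Finset (Fin N) :=
  (Finset.univ.filter fun v => c v = k).map (Function.Embedding.subtype _)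

lemma mem_block {N d s : ℕ} {r : Fin N} {c : {v : Fin N // v ≠ r} → Fin d × Fin s}
    {k : Fin d × Fin s} {v : Fin N} : v ∈ block r c k ↔ ∃ h : v ≠ r, c ⟨v, h⟩ = k := by
  simp [block]

/-- The families of rooted hypertrees on the blocks of the colouring `c`. -/
def pieces {N d s : ℕ} (r : Fin N) (c : {v : Fin N // v ≠ r} → Fin d × Fin s) :
    Finset (Fin d × Fin s → Fin N × Finset (Finset (Fin N))) :=
  Fintype.piFinset fun k => block r c k ×ˢ treesOn s (block r c k)

lemma isPieces_of_mem {N d s : ℕ} {r : Fin N} {c : {v : Fin N // v ≠ r} → Fin d × Fin s}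
    {p : Fin d × Fin s → Fin N × Finset (Finset (Fin N))} (hp : p ∈ pieces r c) :
    IsPieces r (block r c) p where
  root_notMem k hk := (mem_block.1 hk).1 rfl
  eq_of_mem k k' v h h' := by
    obtain ⟨_, rfl⟩ := mem_block.1 h
    obtain ⟨_, rfl⟩ := mem_block.1 h'
    rfl
  exists_mem v hv := ⟨c ⟨v, hv⟩, mem_block.2 ⟨hv, rfl⟩⟩
  mem k := (Finset.mem_product.1 (Fintype.mem_piFinset.1 hp k)).1
  tree k := (Finset.mem_product.1 (Fintype.mem_piFinset.1 hp k)).2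

lemma sum_glue {N d s : ℕ} (hs : 1 ≤ s) (r : Fin N) (w : Finset (Finset (Fin N)) → ℝ) :
    ∑ E ∈ treesOn s (Finset.univ : Finset (Fin N)),
      ∑ _ρ ∈ Finset.univ.filter (fun ρ : Fin d × Fin s → Fin N => EnumStar r E ρ), w E =
    ∑ c : {v : Fin N // v ≠ r} → Fin d × Fin s, ∑ p ∈ pieces r c, w (glue r p) := by
  rw [Finset.sum_sigma', Finset.sum_sigma']
  symm
  refine Finset.sum_bij (fun x _ => ⟨glue r x.2, fun k => (x.2 k).1⟩) ?_ ?_ ?_ ?_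
  · rintro ⟨c, p⟩ hx
    have h := isPieces_of_mem (Finset.mem_sigma.1 hx).2
    simp only [Finset.mem_sigma, Finset.mem_filter, Finset.mem_univ, true_and]
    exact ⟨h.glue_mem_treesOn hs, h.enumStar hs⟩
  · rintro ⟨c, p⟩ hx ⟨c', p'⟩ hx' heq
    have h := isPieces_of_mem (Finset.mem_sigma.1 hx).2
    have h' := isPieces_of_mem (Finset.mem_sigma.1 hx').2
    simp only [Sigma.mk.injEq, heq_eq_eq] at heq
    obtain ⟨h1, h2⟩ := heq
    have hρ : ∀ k, (p k).1 = (p' k).1 := fun k => congrFun h2 k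
    have hF : forest p = forest p' := by
      rw [← h.filter_root_notMem, ← h'.filter_root_notMem, h1]
    have hS : block r c = block r c' := by
      ext k v
      rw [h.mem_iff_reachable, h'.mem_iff_reachable, hρ, hF]
    have hp : p = p' := by
      funext k
      refine Prod.ext (hρ k) ?_
      rw [h.piece_eq_filter, h'.piece_eq_filter, hF, hS]
    have hc : c = c' := by
      funext ⟨v, hv⟩
      have : v ∈ block r c' (c ⟨v, hv⟩) := by
        rw [← hS]; exact mem_block.2 ⟨hv, rfl⟩
      obtain ⟨_, h3⟩ := mem_block.1 this
      exact h3.symm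
    rw [hc, hp]
  · rintro ⟨E, ρ⟩ hx
    simp only [Finset.mem_sigma, Finset.mem_filter, Finset.mem_univ, true_and] at hx
    obtain ⟨S, p, h, hE, hρ⟩ := exists_isPieces r E hx.1 ρ hx.2
    choose c hc using fun v : {v : Fin N // v ≠ r} => h.exists_mem v v.2
    have hS : block r c = S := by
      ext k v
      rw [mem_block]
      constructor
      · rintro ⟨hv, rfl⟩
        exact hc ⟨v, hv⟩
      · intro hv
        have hvr : v ≠ r := fun hh => h.root_notMem k (hh ▸ hv)
        exact ⟨hvr, h.eq_of_mem _ _ v (hc ⟨v, hvr⟩) hv⟩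
    refine ⟨⟨c, p⟩, ?_, ?_⟩
    · simp only [Finset.mem_sigma, Finset.mem_univ, true_and]
      refine Fintype.mem_piFinset.2 fun k => Finset.mem_product.2 ?_
      rw [hS]
      exact ⟨h.mem k, h.tree k⟩
    · simp only [hE, Sigma.mk.injEq, heq_eq_eq, true_and]
      exact funext hρ
  · intros; rfl

lemma card_image_eq {α : Type*} [DecidableEq α] {s : ℕ} (F : Finset α) (hF : F.card = s) :
    Nat.card {f : Fin s → α // Finset.univ.image f = F} = s.factorial := by
  have e : (Fin s ↪ F) ≃ {f : Fin s → α // Finset.univ.image f = F} :=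
    Equiv.ofBijective (fun g => ⟨fun i => (g i : α), by
      refine Finset.eq_of_subset_of_card_le ?_ ?_
      · intro x hx
        obtain ⟨i, -, rfl⟩ := Finset.mem_image.1 hx
        exact (g i).2
      · rw [Finset.card_image_of_injective (f := fun i => (g i : α)) _
          (Subtype.val_injective.comp g.injective)]
        simp [hF]⟩) (by
      constructor
      · intro g g' h
        ext i
        exact congrFun (Subtype.ext_iff.1 h) i
      · rintro ⟨f, hf⟩
        have hinj : Function.Injective f := by
          have h1 : (Finset.univ.image f).card = (Finset.univ : Finset (Fin s)).card := by
            rw [hf, hF]; simp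
          exact Set.injOn_univ.1 (by simpa using Finset.card_image_iff.1 h1)
        refine ⟨⟨fun i => ⟨f i, hf ▸ Finset.mem_image_of_mem f (Finset.mem_univ i)⟩,
          fun i j h => hinj (congrArg Subtype.val h)⟩, rfl⟩)
  rw [← Nat.card_congr e, Nat.card_eq_fintype_card, Fintype.card_embedding_eq]
  simp [hF, Nat.descFactorial_self]

lemma starEdge_eq_iff {N d s : ℕ} {r : Fin N} {ρ : Fin d × Fin s → Fin N} {i : Fin d}
    {e : Finset (Fin N)} (he : e.card = s + 1) (hr : r ∈ e) :
    starEdge r ρ i = e ↔ Finset.univ.image (fun j => ρ (i, j)) = e.erase r := by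
  have hcard : (e.erase r).card = s := by rw [Finset.card_erase_of_mem hr, he]; rfl
  constructor
  · intro h
    symm
    refine Finset.eq_of_subset_of_card_le ?_ ?_
    · rw [← h]
      intro v hv
      exact (Finset.mem_insert.1 (Finset.mem_of_mem_erase hv)).resolve_left
        (Finset.ne_of_mem_erase hv)
    · rw [hcard]
      simpa using Finset.card_image_le (s := Finset.univ) (f := fun j => ρ (i, j))
  · intro h
    rw [starEdge, h, Finset.insert_erase hr]

lemma card_enumStar {N d s : ℕ} (r : Fin N) (E : Finset (Finset (Fin N)))
    (hE : ∀ e ∈ E, e.card = s + 1) :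
    (Finset.univ.filter (fun ρ : Fin d × Fin s → Fin N => EnumStar r E ρ)).card =
      if (E.filter fun e => r ∈ e).card = d then d.factorial * s.factorial ^ d else 0 := by
  split_ifs with hd
  · have e1 : {ρ : Fin d × Fin s → Fin N // EnumStar r E ρ} ≃
        Σ σ : {σ : Fin d → Finset (Fin N) // Finset.univ.image σ = E.filter fun e => r ∈ e},
          ∀ i, {f : Fin s → Fin N // Finset.univ.image f = (σ.1 i).erase r} := by
      have hmem : ∀ (σ : {σ : Fin d → Finset (Fin N) //
          Finset.univ.image σ = E.filter fun e => r ∈ e}) (i : Fin d),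
          (σ.1 i).card = s + 1 ∧ r ∈ σ.1 i := fun σ i => by
        have : σ.1 i ∈ E.filter fun e => r ∈ e :=
          σ.2.subset (Finset.mem_image_of_mem _ (Finset.mem_univ i))
        exact ⟨hE _ (Finset.mem_filter.1 this).1, (Finset.mem_filter.1 this).2⟩
      have hext : ∀ x y : (Σ σ : {σ : Fin d → Finset (Fin N) //
          Finset.univ.image σ = E.filter fun e => r ∈ e},
          ∀ i, {f : Fin s → Fin N // Finset.univ.image f = (σ.1 i).erase r}),
          x.1.1 = y.1.1 → (∀ i, (x.2 i).1 = (y.2 i).1) → x = y := by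
        rintro ⟨⟨σ, _⟩, f⟩ ⟨⟨σ', _⟩, f'⟩ h1 h2
        simp only at h1
        subst h1
        congr
        funext i
        exact Subtype.ext (h2 i)
      exact
      { toFun := fun ρ => ⟨⟨starEdge r ρ.1, ρ.2.1⟩, fun i => ⟨fun j => ρ.1 (i, j),
          (starEdge_eq_iff (hmem ⟨starEdge r ρ.1, ρ.2.1⟩ i).1
            (hmem ⟨starEdge r ρ.1, ρ.2.1⟩ i).2).1 rfl⟩⟩
        invFun := fun x => ⟨fun k => (x.2 k.1).1 k.2, by
          have h1 : starEdge r (fun k : Fin d × Fin s => (x.2 k.1).1 k.2) = x.1.1 := by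
            funext i
            exact (starEdge_eq_iff (hmem x.1 i).1 (hmem x.1 i).2).2 (x.2 i).2
          refine ⟨by rw [h1, x.1.2], ?_⟩
          rw [h1]
          have h2 : (Finset.univ.image x.1.1).card = (Finset.univ : Finset (Fin d)).card := by
            rw [x.1.2, hd]; simp
          exact Set.injOn_univ.1 (by simpa using Finset.card_image_iff.1 h2)⟩
        left_inv := fun ρ => rfl
        right_inv := by
          rintro ⟨⟨σ, hσ⟩, f⟩
          have h1 : starEdge r (fun k : Fin d × Fin s => (f k.1).1 k.2) = σ := by
            funext i
            exact (starEdge_eq_iff (hmem ⟨σ, hσ⟩ i).1 (hmem ⟨σ, hσ⟩ i).2).2 (f i).2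
          exact hext _ _ h1 fun i => rfl }
    have h0 : (Finset.univ.filter (fun ρ : Fin d × Fin s → Fin N => EnumStar r E ρ)).card =
        Nat.card {ρ : Fin d × Fin s → Fin N // EnumStar r E ρ} := by
      rw [Nat.card_eq_fintype_card, Fintype.card_subtype]
    rw [h0, Nat.card_congr e1, Nat.card_sigma]
    have h1 : ∀ σ : {σ : Fin d → Finset (Fin N) //
        Finset.univ.image σ = E.filter fun e => r ∈ e},
        Nat.card (∀ i, {f : Fin s → Fin N // Finset.univ.image f = (σ.1 i).erase r}) =
          s.factorial ^ d := by
      intro σ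
      rw [Nat.card_pi]
      rw [Finset.prod_congr rfl (g := fun _ => s.factorial)]
      · simp
      · intro i _
        have : σ.1 i ∈ E.filter fun e => r ∈ e :=
          σ.2.subset (Finset.mem_image_of_mem _ (Finset.mem_univ i))
        obtain ⟨h2, h3⟩ := Finset.mem_filter.1 this
        exact card_image_eq _ (by rw [Finset.card_erase_of_mem h3, hE _ h2]; rfl)
    rw [Finset.sum_congr rfl fun σ _ => h1 σ, Finset.sum_const, Finset.card_univ,
      ← Nat.card_eq_fintype_card, card_image_eq _ hd, smul_eq_mul]
  · rw [Finset.card_eq_zero, Finset.filter_eq_empty_iff]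
    intro ρ _ h
    apply hd
    rw [← h.1, Finset.card_image_of_injective _ h.2, Finset.card_univ, Fintype.card_fin]

/-- Summing over hypertrees is summing over root degrees and pieces. -/
lemma sum_treesOn_eq {n s : ℕ} (hs : 1 ≤ s) (r : Fin (n + 1))
    (w : Finset (Finset (Fin (n + 1))) → ℝ) :
    ∑ E ∈ treesOn s (Finset.univ : Finset (Fin (n + 1))), w E =
      ∑ d ∈ Finset.range (n + 1), ((d.factorial * s.factorial ^ d : ℕ) : ℝ)⁻¹ *
        ∑ c : {v : Fin (n + 1) // v ≠ r} → Fin d × Fin s, ∑ p ∈ pieces r c, w (glue r p) := by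
  have hdeg : ∀ E ∈ treesOn s (Finset.univ : Finset (Fin (n + 1))),
      (E.filter fun e => r ∈ e).card ∈ Finset.range (n + 1) := by
    intro E hE
    have h1 := (mem_treesOn.1 hE).2.2
    have h2 := Finset.card_filter_le E fun e => r ∈ e
    simp only [Finset.card_univ, Fintype.card_fin] at h1
    have h3 : E.card ≤ s * E.card := Nat.le_mul_of_pos_left _ hs
    exact Finset.mem_range.2 (by omega)
  rw [← Finset.sum_fiberwise_of_maps_to hdeg]
  refine Finset.sum_congr rfl fun d _ => ?_
  rw [← sum_glue hs r w]
  have hne : ((d.factorial * s.factorial ^ d : ℕ) : ℝ) ≠ 0 :=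
    Nat.cast_ne_zero.2 (Nat.mul_ne_zero d.factorial_ne_zero (pow_ne_zero _ s.factorial_ne_zero))
  rw [eq_inv_mul_iff_mul_eq₀ hne, Finset.sum_filter, Finset.mul_sum]
  refine Finset.sum_congr rfl fun E hE => ?_
  rw [Finset.sum_const, card_enumStar r E fun e he => ((mem_treesOn.1 hE).1 e he).1]
  split_ifs <;> simp

lemma card_fiber_eq_multinomial {W κ : Type*} [Fintype W] [Fintype κ] [DecidableEq W]
    [DecidableEq κ] (m : κ → ℕ)
    (hm : ∑ k, m k = Fintype.card W) :
    (Finset.univ.filter fun c : W → κ =>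
      (fun k => (Finset.univ.filter fun w => c w = k).card) = m).card =
      Nat.multinomial Finset.univ m := by
  have h1 : (∑ k : κ, (MvPolynomial.X k : MvPolynomial κ ℕ)) ^ Fintype.card W =
      ∑ c : W → κ, MvPolynomial.monomial (Finsupp.equivFunOnFinite.symm
        fun k => (Finset.univ.filter fun w => c w = k).card) 1 := by
    rw [← Finset.card_univ, ← Finset.prod_const, Finset.prod_univ_sum, Fintype.piFinset_univ]
    refine Finset.sum_congr rfl fun c _ => ?_
    rw [MvPolynomial.monomial_eq, Finsupp.prod_fintype _ _ (by simp), map_one, one_mul,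
      ← Finset.prod_fiberwise (g := c)]
    refine Finset.prod_congr rfl fun k _ => ?_
    rw [Finset.prod_congr rfl (g := fun _ => (MvPolynomial.X k : MvPolynomial κ ℕ))
      fun w hw => by rw [(Finset.mem_filter.1 hw).2], Finset.prod_const]
    rfl
  have h2 : (∑ k : κ, (MvPolynomial.X k : MvPolynomial κ ℕ)) ^ Fintype.card W =
      ∑ f ∈ Finset.piAntidiag Finset.univ (Fintype.card W),
        MvPolynomial.monomial (Finsupp.equivFunOnFinite.symm f)
          (Nat.multinomial Finset.univ f) := by
    rw [Finset.sum_pow_eq_sum_piAntidiag]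
    refine Finset.sum_congr rfl fun f _ => ?_
    rw [MvPolynomial.monomial_eq, Finsupp.prod_fintype _ _ (by simp)]
    rfl
  have h3 := congrArg (MvPolynomial.coeff (Finsupp.equivFunOnFinite.symm m)) (h1.symm.trans h2)
  simp only [MvPolynomial.coeff_sum, MvPolynomial.coeff_monomial,
    EmbeddingLike.apply_eq_iff_eq] at h3
  rw [Finset.sum_ite_eq' _ m, if_pos (by simp [hm])] at h3
  rw [← h3, Finset.card_filter]

lemma sum_card_fiber {W κ : Type*} [Fintype W] [Fintype κ] [DecidableEq W] [DecidableEq κ]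
    (G : (κ → ℕ) → ℝ) :
    ∑ c : W → κ, G (fun k => (Finset.univ.filter fun w => c w = k).card) =
      ∑ m ∈ Finset.piAntidiag Finset.univ (Fintype.card W),
        (Nat.multinomial Finset.univ m : ℝ) * G m := by
  have hmap : ∀ c ∈ (Finset.univ : Finset (W → κ)),
      (fun k => (Finset.univ.filter fun w => c w = k).card) ∈
        Finset.piAntidiag Finset.univ (Fintype.card W) := by
    intro c _
    simp only [Finset.mem_piAntidiag, Finset.mem_univ, implies_true, and_true]
    rw [← Finset.card_eq_sum_card_fiberwise (f := c) (by simp), Finset.card_univ]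
  rw [← Finset.sum_fiberwise_of_maps_to hmap]
  refine Finset.sum_congr rfl fun m hm => ?_
  rw [Finset.sum_congr rfl (g := fun _ => G m) fun c hc => by rw [(Finset.mem_filter.1 hc).2],
    Finset.sum_const, nsmul_eq_mul,
    card_fiber_eq_multinomial m (Finset.mem_piAntidiag.1 hm).1]

lemma measurable_K : Measurable fun p : (ℝ × ℝ) × (ℝ × ℝ) => K p.1 p.2 := by
  have h : ∀ f g : (ℝ × ℝ) × (ℝ × ℝ) → ℝ, Measurable f → Measurable g →
      MeasurableSet {p | f p < g p} := fun f g hf hg => measurableSet_lt hf hg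
  have h1 : Measurable fun p : (ℝ × ℝ) × (ℝ × ℝ) => p.1.1 := by fun_prop
  have h2 : Measurable fun p : (ℝ × ℝ) × (ℝ × ℝ) => p.1.2 := by fun_prop
  have h3 : Measurable fun p : (ℝ × ℝ) × (ℝ × ℝ) => p.2.1 := by fun_prop
  have h4 : Measurable fun p : (ℝ × ℝ) × (ℝ × ℝ) => p.2.2 := by fun_prop
  exact Measurable.ite (((h _ _ h1 h3).inter ((h _ _ h3 h2).inter (h _ _ h2 h4))).union
    ((h _ _ h3 h1).inter ((h _ _ h1 h4).inter (h _ _ h4 h2)))) measurable_const measurable_const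

lemma Measurable.K {α : Type*} [MeasurableSpace α] {f g : α → ℝ × ℝ} (hf : Measurable f)
    (hg : Measurable g) : Measurable fun a => K (f a) (g a) :=
  measurable_K.comp (hf.prodMk hg)

lemma abs_K (x y : ℝ × ℝ) : |K x y| = 1 := by
  unfold K; split_ifs <;> simp

instance : IsProbabilityMeasure nu := by
  unfold nu
  have : IsProbabilityMeasure ((volume : Measure (ℝ × ℝ)).restrict
      (Set.Icc (0 : ℝ) 1 ×ˢ Set.Icc (0 : ℝ) 1)) := by
    constructor
    rw [Measure.restrict_apply_univ, Measure.volume_eq_prod, Measure.prod_prod]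
    simp
  exact Measure.isProbabilityMeasure_map (by fun_prop)

lemma measurableSet_Omega : MeasurableSet Omega := measurableSet_Icc.prod measurableSet_Icc

lemma nu_restrict : nu.restrict Omega = nu := by
  refine Measure.restrict_eq_self_of_ae_mem ?_
  unfold nu
  refine (ae_map_iff (p := fun y => y ∈ Omega) (by fun_prop) measurableSet_Omega).2 ?_
  filter_upwards [ae_restrict_mem (measurableSet_Icc.prod measurableSet_Icc)] with p hp
  simp only [Set.mem_prod, Set.mem_Icc] at hp
  simp only [Omega, Set.mem_prod, Set.mem_Icc, le_min_iff, max_le_iff, min_le_iff, le_max_iff]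
  tauto

/-- The integrand defining `bTr`. -/
def weight {N : ℕ} (E : Finset (Finset (Fin N))) (r : Fin N) (x : ℝ × ℝ)
    (X : Finset (Fin N) → ℝ × ℝ) : ℝ :=
  (∏ e ∈ E.filter (fun e => r ∈ e), K x (X e)) * BE E X

lemma measurable_pairSign {N : ℕ} (z : Sym2 (Finset (Fin N))) :
    Measurable fun X : Finset (Fin N) → ℝ × ℝ => pairSign X z := by
  induction z with
  | _ e f =>
    simp only [pairSign, Sym2.lift_mk]
    split_ifs
    · exact Measurable.K (measurable_pi_apply e) (measurable_pi_apply f)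
    · exact measurable_const

lemma abs_pairSign {N : ℕ} (X : Finset (Fin N) → ℝ × ℝ) (z : Sym2 (Finset (Fin N))) :
    |pairSign X z| = 1 := by
  induction z with
  | _ e f =>
    simp only [pairSign, Sym2.lift_mk]
    split_ifs
    · exact abs_K _ _
    · simp

lemma measurable_weight {N : ℕ} (E : Finset (Finset (Fin N))) (r : Fin N) :
    Measurable fun p : (ℝ × ℝ) × (Finset (Fin N) → ℝ × ℝ) => weight E r p.1 p.2 := by
  unfold weight BE
  refine Measurable.mul (Finset.measurable_prod _ fun e _ => ?_)
    (Finset.measurable_prod _ fun z _ => ?_)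
  · exact Measurable.K measurable_fst ((measurable_pi_apply e).comp measurable_snd)
  · exact (measurable_pairSign z).comp measurable_snd

lemma abs_weight {N : ℕ} (E : Finset (Finset (Fin N))) (r : Fin N) (x : ℝ × ℝ)
    (X : Finset (Fin N) → ℝ × ℝ) : |weight E r x X| = 1 := by
  simp [weight, BE, abs_mul, Finset.abs_prod, abs_K, abs_pairSign]

lemma bTr_eq {N : ℕ} (E : Finset (Finset (Fin N))) (r : Fin N) (x : ℝ × ℝ) :
    bTr E r x = ∫ X, weight E r x X ∂(Measure.pi fun _ => nu) := rfl

lemma measurable_bTr {N : ℕ} (E : Finset (Finset (Fin N))) (r : Fin N) :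
    Measurable fun x => bTr E r x := by
  simp only [bTr_eq]
  exact ((measurable_weight E r).stronglyMeasurable.integral_prod_right').measurable

lemma abs_bTr_le {N : ℕ} (E : Finset (Finset (Fin N))) (r : Fin N) (x : ℝ × ℝ) :
    |bTr E r x| ≤ 1 := by
  rw [bTr_eq]
  have := norm_integral_le_of_norm_le_const (μ := Measure.pi fun _ : Finset (Fin N) => nu)
    (f := weight E r x) (C := 1) (Filter.Eventually.of_forall fun X => (abs_weight E r x X).le)
  simpa using this

lemma measurable_pairProd (d : ℕ) : Measurable (pairProd d) := by
  unfold pairProd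
  exact Finset.measurable_prod _ fun p _ =>
    Measurable.K (measurable_pi_apply p.1) (measurable_pi_apply p.2)

lemma abs_pairProd (d : ℕ) (y : Fin d → ℝ × ℝ) : |pairProd d y| = 1 := by
  simp [pairProd, Finset.abs_prod, abs_K]

lemma BE_insert {N : ℕ} (X : Finset (Fin N) → ℝ × ℝ) (e : Finset (Fin N))
    (E : Finset (Finset (Fin N))) (he : e ∉ E) :
    BE (insert e E) X = (∏ f ∈ E, pairSign X s(e, f)) * BE E X := by
  have h1 : (insert e E).sym2.filter (fun p => ¬ p.IsDiag) =
      E.image (fun f => s(e, f)) ∪ E.sym2.filter (fun p => ¬ p.IsDiag) := by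
    ext z
    induction z with
    | _ a b =>
      simp only [Finset.mem_filter, Finset.mk_mem_sym2_iff, Finset.mem_insert, Sym2.mk_isDiag_iff,
        Finset.mem_union, Finset.mem_image, Sym2.eq_iff]
      grind
  have h2 : Disjoint (E.image (fun f => s(e, f))) (E.sym2.filter (fun p => ¬ p.IsDiag)) := by
    refine Finset.disjoint_left.2 fun z hz hz' => ?_
    obtain ⟨f, hf, rfl⟩ := Finset.mem_image.1 hz
    exact he (Finset.mk_mem_sym2_iff.1 (Finset.mem_filter.1 hz').1).1
  rw [BE, h1, Finset.prod_union h2, Finset.prod_image, BE]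
  intro a _ b _ hab
  exact Sym2.congr_right.1 hab

lemma BE_union {N : ℕ} (X : Finset (Fin N) → ℝ × ℝ) (E F : Finset (Finset (Fin N)))
    (h : Disjoint E F) :
    BE (E ∪ F) X = BE E X * BE F X * ∏ e ∈ E, ∏ f ∈ F, pairSign X s(e, f) := by
  induction E using Finset.induction_on with
  | empty => simp [BE]
  | insert e E he ih =>
    rw [Finset.disjoint_insert_left] at h
    rw [Finset.insert_union, BE_insert X e _ (by simp [he, h.1]), ih h.2, BE_insert X e E he,
      Finset.prod_insert he, Finset.prod_union h.2]
    ring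

lemma BE_image {N d : ℕ} (X : Finset (Fin N) → ℝ × ℝ) (e : Fin d → Finset (Fin N))
    (he : Function.Injective e) (hodd : ∀ i j, i ≠ j → Odd (e i ∩ e j).card) :
    BE (Finset.univ.image e) X = pairProd d fun i => X (e i) := by
  symm
  refine Finset.prod_bij (fun p _ => s(e p.1, e p.2)) ?_ ?_ ?_ ?_
  · intro p hp
    have hp' := (Finset.mem_filter.1 hp).2
    simp [he.eq_iff, hp'.ne]
  · intro p hp p' hp' h
    have h1 := (Finset.mem_filter.1 hp).2
    have h2 := (Finset.mem_filter.1 hp').2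
    rw [Sym2.eq_iff, he.eq_iff, he.eq_iff, he.eq_iff, he.eq_iff] at h
    rcases h with h | h
    · exact Prod.ext h.1 h.2
    · rw [h.1, h.2] at h1
      exact absurd h1 h2.asymm
  · intro z
    induction z with
    | _ a b =>
      simp only [Finset.mem_filter, Finset.mk_mem_sym2_iff, Finset.mem_image, Finset.mem_univ,
        true_and, Sym2.mk_isDiag_iff]
      rintro ⟨⟨⟨i, rfl⟩, ⟨j, rfl⟩⟩, hij⟩
      rw [he.eq_iff] at hij
      rcases lt_or_gt_of_ne hij with h | h
      · exact ⟨(i, j), by simpa using h, rfl⟩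
      · exact ⟨(j, i), by simpa using h, Sym2.eq_swap⟩
  · intro p hp
    have hp' := (Finset.mem_filter.1 hp).2
    simp only [pairSign, Sym2.lift_mk]
    rw [if_pos (hodd _ _ hp'.ne)]

namespace IsPieces

variable {N d s : ℕ} {r : Fin N} {S : Fin d × Fin s → Finset (Fin N)}
  {p : Fin d × Fin s → Fin N × Finset (Finset (Fin N))}

lemma BE_forest (h : IsPieces r S p) (X : Finset (Fin N) → ℝ × ℝ) :
    BE (forest p) X = ∏ k, BE (p k).2 X := by
  have key : ∀ A : Finset (Fin d × Fin s),
      BE (A.biUnion fun k => (p k).2) X = ∏ k ∈ A, BE (p k).2 X := by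
    intro A
    induction A using Finset.induction_on with
    | empty => simp [BE]
    | insert k A hk ih =>
      rw [Finset.biUnion_insert, BE_union, ih, Finset.prod_insert hk,
        Finset.prod_eq_one (s := (p k).2), mul_one]
      · intro e he
        refine Finset.prod_eq_one fun f hf => ?_
        obtain ⟨k', hk', hf⟩ := Finset.mem_biUnion.1 hf
        have hdisj : e ∩ f = ∅ := by
          refine Finset.disjoint_iff_inter_eq_empty.1 (Finset.disjoint_left.2 fun v hv hv' => hk ?_)
          rwa [h.eq_of_mem k k' v (h.edge_subset he hv) (h.edge_subset hf hv')]
        simp [pairSign, hdisj]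
      · refine Finset.disjoint_left.2 fun e he he' => hk ?_
        obtain ⟨k', hk', hf⟩ := Finset.mem_biUnion.1 he'
        rwa [h.eq_of_edge he (h.edge_subset hf)]
  exact key _

lemma starEdge_inter_starEdge (h : IsPieces r S p) {i j : Fin d} (hij : i ≠ j) :
    starEdge r (fun k => (p k).1) i ∩ starEdge r (fun k => (p k).1) j = {r} := by
  ext v
  rw [Finset.mem_inter, Finset.mem_singleton]
  constructor
  · rintro ⟨h1, h2⟩
    by_contra hv
    obtain ⟨k, hk⟩ := h.exists_mem v hv
    rw [h.mem_starEdge_iff hk] at h1 h2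
    exact hij (h1.1.symm.trans h2.1)
  · rintro rfl
    exact ⟨Finset.mem_insert_self _ _, Finset.mem_insert_self _ _⟩

lemma pairSign_starEdge (h : IsPieces r S p) (X : Finset (Fin N) → ℝ × ℝ) (i : Fin d) {k}
    {f : Finset (Fin N)} (hf : f ∈ (p k).2) :
    pairSign X s(starEdge r (fun k => (p k).1) i, f) =
      if k.1 = i then
        (if (p k).1 ∈ f then K (X (starEdge r (fun k => (p k).1) i)) (X f) else 1) else 1 := by
  have hint : starEdge r (fun k => (p k).1) i ∩ f =
      if k.1 = i ∧ (p k).1 ∈ f then {(p k).1} else ∅ := by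
    ext v
    split_ifs with hc
    · rw [Finset.mem_inter, Finset.mem_singleton]
      constructor
      · rintro ⟨h1, h2⟩
        exact ((h.mem_starEdge_iff (h.edge_subset hf h2)).1 h1).2
      · rintro rfl
        exact ⟨(h.mem_starEdge_iff (h.mem k)).2 ⟨hc.1, rfl⟩, hc.2⟩
    · simp only [Finset.mem_inter, Finset.notMem_empty, iff_false, not_and]
      intro h1 h2
      obtain ⟨h3, rfl⟩ := (h.mem_starEdge_iff (h.edge_subset hf h2)).1 h1
      exact hc ⟨h3, h2⟩
  simp only [pairSign, Sym2.lift_mk, hint]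
  by_cases h1 : k.1 = i <;> by_cases h2 : (p k).1 ∈ f <;> simp [h1, h2]

lemma weight_glue (h : IsPieces r S p) (hs : 1 ≤ s) (x : ℝ × ℝ)
    (X : Finset (Fin N) → ℝ × ℝ) :
    weight (glue r p) r x X =
      ((∏ i, K x (X (starEdge r (fun k => (p k).1) i))) *
        pairProd d fun i => X (starEdge r (fun k => (p k).1) i)) *
      ∏ k, weight (p k).2 (p k).1 (X (starEdge r (fun k => (p k).1) k.1)) X := by
  have hinj := h.starEdge_injective hs
  rw [weight, h.filter_root_mem, Finset.prod_image hinj.injOn, glue,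
    BE_union X _ _ h.disjoint_star_forest, h.BE_forest, BE_image X _ hinj fun i j hij => by
      rw [h.starEdge_inter_starEdge hij]; simp]
  rw [Finset.prod_image hinj.injOn]
  have hcross : ∏ i, ∏ f ∈ forest p, pairSign X s(starEdge r (fun k => (p k).1) i, f) =
      ∏ k, ∏ e ∈ (p k).2.filter (fun e => (p k).1 ∈ e),
        K (X (starEdge r (fun k => (p k).1) k.1)) (X e) := by
    have h1 : ∀ i, ∏ f ∈ forest p, pairSign X s(starEdge r (fun k => (p k).1) i, f) =
        ∏ k, ∏ f ∈ (p k).2, if k.1 = i then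
          (if (p k).1 ∈ f then K (X (starEdge r (fun k => (p k).1) i)) (X f) else 1) else 1 := by
      intro i
      rw [forest, Finset.prod_biUnion]
      · exact Finset.prod_congr rfl fun k _ => Finset.prod_congr rfl fun f hf =>
          h.pairSign_starEdge X i hf
      · intro k _ k' _ hkk'
        exact Finset.disjoint_left.2 fun e he he' => hkk' (h.eq_of_edge he (h.edge_subset he'))
    rw [Finset.prod_congr rfl fun i _ => h1 i, Finset.prod_comm]
    refine Finset.prod_congr rfl fun k _ => ?_
    rw [Finset.prod_comm, Finset.prod_filter]
    refine Finset.prod_congr rfl fun f _ => ?_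
    rw [Finset.prod_ite_eq]
    simp
  rw [hcross]
  simp only [weight, Finset.prod_mul_distrib]
  ring

end IsPieces

lemma integral_pi_comp_of_injective {ι κ : Type*} [Fintype ι] [Fintype κ] {J : ι → κ}
    (hJ : Function.Injective J) {F : (ι → ℝ × ℝ) → ℝ} (hF : Measurable F) :
    ∫ W : κ → ℝ × ℝ, F (fun i => W (J i)) ∂(Measure.pi fun _ => nu) =
      ∫ X, F X ∂(Measure.pi fun _ => nu) := by
  have h := Measure.map_infinitePi_infinitePi_of_inj (P := fun _ : κ => nu) hJ
  simp only [Measure.infinitePi_eq_pi] at h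
  rw [← h, integral_map (measurable_pi_lambda _ fun i => measurable_pi_apply (J i)).aemeasurable
    hF.aestronglyMeasurable]

lemma integral_pi_prod_curry {ι κ : Type*} [Fintype ι] [Fintype κ]
    (f : κ → (ι → ℝ × ℝ) → ℝ) (hf : ∀ k, Measurable (f k)) :
    ∫ V : κ × ι → ℝ × ℝ, ∏ k, f k (fun a => V (k, a)) ∂(Measure.pi fun _ => nu) =
      ∏ k, ∫ X, f k X ∂(Measure.pi fun _ => nu) := by
  have h := Measure.infinitePi_map_curry (fun (_ : κ) (_ : ι) => nu)
  simp only [Measure.infinitePi_eq_pi] at h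
  have hm : Measurable fun x : κ → ι → ℝ × ℝ => ∏ k, f k (x k) :=
    Finset.measurable_prod _ fun k _ => (hf k).comp (measurable_pi_apply k)
  rw [← integral_fintype_prod_eq_prod, ← h, integral_map
    (MeasurableEquiv.measurable _).aemeasurable hm.aestronglyMeasurable]
  rfl

lemma integral_pi_sum {ι κ : Type*} [Fintype ι] [Fintype κ]
    {F : (ι → ℝ × ℝ) → (κ → ℝ × ℝ) → ℝ} (hF : Measurable fun p : _ × _ => F p.1 p.2)
    (hb : ∀ y V, |F y V| ≤ 1) :
    ∫ W : ι ⊕ κ → ℝ × ℝ, F (fun i => W (.inl i)) (fun k => W (.inr k))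
        ∂(Measure.pi fun _ => nu) =
      ∫ y, ∫ V, F y V ∂(Measure.pi fun _ => nu) ∂(Measure.pi fun _ => nu) := by
  have h := (measurePreserving_sumPiEquivProdPi (fun _ : ι ⊕ κ => nu)).integral_comp'
    (fun p => F p.1 p.2)
  rw [integral_prod (fun p => F p.1 p.2) (Integrable.of_bound hF.aestronglyMeasurable 1
    (Filter.Eventually.of_forall fun p => hb _ _))] at h
  exact h

lemma abs_prod_le_one {ι : Type*} (A : Finset ι) {f : ι → ℝ} (h : ∀ i ∈ A, |f i| ≤ 1) :
    |∏ i ∈ A, f i| ≤ 1 := by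
  rw [Finset.abs_prod]
  exact Finset.prod_le_one (fun i _ => abs_nonneg _) h

lemma integral_star {ι κ : Type*} [Fintype ι] [Fintype κ] {d : ℕ} {e : Fin d → ι}
    (he : Function.Injective e) {T : κ → Finset ι}
    (hT : ∀ k k' a, a ∈ T k → a ∈ T k' → k = k') (heT : ∀ i k, e i ∉ T k) (π : κ → Fin d)
    {Φ : (Fin d → ℝ × ℝ) → ℝ} (hΦ : Measurable Φ) (hΦ1 : ∀ y, |Φ y| ≤ 1)
    {g : κ → ℝ × ℝ → (ι → ℝ × ℝ) → ℝ} (hg : ∀ k, Measurable fun p : _ × _ => g k p.1 p.2)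
    (hg1 : ∀ k y X, |g k y X| ≤ 1)
    (hdep : ∀ k y X X', (∀ a ∈ T k, X a = X' a) → g k y X = g k y X') :
    ∫ X : ι → ℝ × ℝ, Φ (fun i => X (e i)) * ∏ k, g k (X (e (π k))) X
        ∂(Measure.pi fun _ => nu) =
      ∫ y, Φ y * ∏ k, ∫ X, g k (y (π k)) X ∂(Measure.pi fun _ => nu)
        ∂(Measure.pi fun _ => nu) := by
  have hm : ∀ a, ∃ o : Option κ, ∀ k, a ∈ T k → o = some k := by
    intro a
    by_cases h : ∃ k, a ∈ T k
    · obtain ⟨k, hk⟩ := h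
      exact ⟨some k, fun k' hk' => by rw [hT k k' a hk hk']⟩
    · exact ⟨none, fun k hk => (h ⟨k, hk⟩).elim⟩
  choose m hm using hm
  have hJ : ∀ a, ∃ j : Fin d ⊕ (Option κ × ι), (∀ i, a = e i → j = .inl i) ∧
      ((∀ i, a ≠ e i) → j = .inr (m a, a)) := by
    intro a
    by_cases h : ∃ i, a = e i
    · obtain ⟨i, rfl⟩ := h
      exact ⟨.inl i, fun i' hi' => by rw [he hi'], fun h => (h i rfl).elim⟩
    · exact ⟨.inr (m a, a), fun i hi => (h ⟨i, hi⟩).elim, fun _ => rfl⟩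
  choose J hJ1 hJ2 using hJ
  have hJe : ∀ i, J (e i) = .inl i := fun i => hJ1 _ i rfl
  have hJT : ∀ k, ∀ a ∈ T k, J a = .inr (some k, a) := fun k a ha => by
    rw [hJ2 a fun i hi => heT i k (hi ▸ ha), hm a k ha]
  have hJinj : Function.Injective J := by
    intro a b hab
    by_cases h : ∃ i, a = e i <;> by_cases h' : ∃ i, b = e i
    · obtain ⟨i, rfl⟩ := h
      obtain ⟨j, rfl⟩ := h'
      rw [hJe, hJe] at hab
      rw [Sum.inl.inj hab]
    · obtain ⟨i, rfl⟩ := h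
      rw [hJe, hJ2 b (not_exists.1 h')] at hab
      exact absurd hab (by simp)
    · obtain ⟨i, rfl⟩ := h'
      rw [hJe, hJ2 a (not_exists.1 h)] at hab
      exact absurd hab (by simp)
    · rw [hJ2 a (not_exists.1 h), hJ2 b (not_exists.1 h')] at hab
      exact congrArg Prod.snd (Sum.inr.inj hab)
  have hF : Measurable fun X : ι → ℝ × ℝ =>
      Φ (fun i => X (e i)) * ∏ k, g k (X (e (π k))) X := by
    refine Measurable.mul (hΦ.comp (by fun_prop)) (Finset.measurable_prod _ fun k _ => ?_)
    exact (hg k).comp (f := fun X : ι → ℝ × ℝ => (X (e (π k)), X))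
      ((measurable_pi_apply _).prodMk measurable_id)
  rw [← integral_pi_comp_of_injective hJinj hF]
  have h1 : ∀ W : Fin d ⊕ (Option κ × ι) → ℝ × ℝ,
      (Φ fun i => W (J (e i))) * ∏ k, g k (W (J (e (π k)))) (fun a => W (J a)) =
      (Φ fun i => W (.inl i)) *
        ∏ k, g k (W (.inl (π k))) (fun a => W (.inr (some k, a))) := by
    intro W
    simp only [hJe]
    congr 1
    refine Finset.prod_congr rfl fun k _ => hdep _ _ _ _ fun a ha => ?_
    rw [hJT k a ha]
  simp only [h1]
  rw [integral_pi_sum (F := fun y (V : Option κ × ι → ℝ × ℝ) =>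
    Φ y * ∏ k, g k (y (π k)) (fun a => V (some k, a)))]
  · refine integral_congr_ae (Filter.Eventually.of_forall fun y => ?_)
    simp only
    rw [integral_const_mul]
    congr 1
    have h2 := integral_pi_prod_curry (κ := Option κ) (ι := ι)
      (fun o X => o.elim 1 fun k => g k (y (π k)) X) (fun o => by
        cases o with
        | none => exact measurable_const
        | some k => exact (hg k).comp measurable_prodMk_left)
    simpa [Fintype.prod_option] using h2
  · refine Measurable.mul (hΦ.comp measurable_fst) (Finset.measurable_prod _ fun k _ => ?_)
    exact (hg k).comp (Measurable.prodMk (by fun_prop) (by fun_prop))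
  · intro y V
    rw [abs_mul]
    exact mul_le_one₀ (hΦ1 y) (abs_nonneg _) (abs_prod_le_one _ fun k _ => hg1 _ _ _)

lemma weight_congr {N : ℕ} {E : Finset (Finset (Fin N))} {r : Fin N} {x : ℝ × ℝ}
    {X X' : Finset (Fin N) → ℝ × ℝ} (h : ∀ e ∈ E, X e = X' e) :
    weight E r x X = weight E r x X' := by
  unfold weight BE
  congr 1
  · exact Finset.prod_congr rfl fun e he => by rw [h e (Finset.mem_filter.1 he).1]
  · refine Finset.prod_congr rfl fun z hz => ?_
    induction z with
    | _ a b =>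
      have := Finset.mk_mem_sym2_iff.1 (Finset.mem_filter.1 hz).1
      simp only [pairSign, Sym2.lift_mk]
      rw [h a this.1, h b this.2]

/-- The weight of the chords `y` of the hyperedges around a root whose own chord is `x`. -/
def starWeight (d : ℕ) (x : ℝ × ℝ) (y : Fin d → ℝ × ℝ) : ℝ :=
  (∏ i, K x (y i)) * pairProd d y

lemma measurable_starWeight (d : ℕ) (x : ℝ × ℝ) : Measurable (starWeight d x) :=
  (Finset.measurable_prod _ fun i _ =>
    Measurable.K measurable_const (measurable_pi_apply i)).mul (measurable_pairProd d)

lemma abs_starWeight (d : ℕ) (x : ℝ × ℝ) (y : Fin d → ℝ × ℝ) : |starWeight d x y| = 1 := by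
  simp [starWeight, abs_mul, Finset.abs_prod, abs_K, abs_pairProd]

lemma IsPieces.bTr_glue {N d s : ℕ} {r : Fin N} {S : Fin d × Fin s → Finset (Fin N)}
    {p : Fin d × Fin s → Fin N × Finset (Finset (Fin N))} (h : IsPieces r S p) (hs : 1 ≤ s)
    (x : ℝ × ℝ) :
    bTr (glue r p) r x =
      ∫ y, starWeight d x y * ∏ k, bTr (p k).2 (p k).1 (y k.1) ∂(Measure.pi fun _ => nu) := by
  rw [bTr_eq]
  simp only [h.weight_glue hs]
  exact integral_star (h.starEdge_injective hs) (T := fun k => (p k).2)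
    (fun k k' a ha ha' => h.eq_of_edge ha (h.edge_subset ha'))
    (fun i k hk => Finset.disjoint_left.1 h.disjoint_star_forest
      (Finset.mem_image_of_mem _ (Finset.mem_univ i))
      (Finset.mem_biUnion.2 ⟨k, Finset.mem_univ _, hk⟩)) Prod.fst
    (measurable_starWeight d x) (fun y => (abs_starWeight d x y).le)
    (g := fun k y X => weight (p k).2 (p k).1 y X)
    (fun k => measurable_weight _ _) (fun k y X => (abs_weight _ _ _ _).le)
    (fun k y X X' hX => weight_congr hX)

section Transport

variable {n N : ℕ} (f : Fin n ↪ Fin N)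

/-- Renaming the vertices of a hypergraph. -/
def mapVerts (E : Finset (Finset (Fin n))) : Finset (Finset (Fin N)) :=
  E.map (Finset.mapEmbedding f).toEmbedding

lemma mem_mapVerts {E : Finset (Finset (Fin n))} {e : Finset (Fin N)} :
    e ∈ mapVerts f E ↔ ∃ e' ∈ E, e'.map f = e := by
  simp [mapVerts]

lemma edgeRel_mapVerts {E : Finset (Finset (Fin n))} {a : Fin n} {y : Fin N} :
    edgeRel (mapVerts f E) (f a) y ↔ ∃ b, f b = y ∧ edgeRel E a b := by
  simp only [edgeRel, mem_mapVerts]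
  constructor
  · rintro ⟨_, ⟨e, he, rfl⟩, ha, hy⟩
    obtain ⟨b, hb, rfl⟩ := Finset.mem_map.1 hy
    exact ⟨b, rfl, e, he, (Finset.mem_map' f).1 ha, hb⟩
  · rintro ⟨b, rfl, e, he, ha, hb⟩
    exact ⟨_, ⟨e, he, rfl⟩, Finset.mem_map_of_mem f ha, Finset.mem_map_of_mem f hb⟩

lemma reflTransGen_mapVerts {E : Finset (Finset (Fin n))} {a b : Fin n} :
    Relation.ReflTransGen (edgeRel (mapVerts f E)) (f a) (f b) ↔
      Relation.ReflTransGen (edgeRel E) a b := by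
  constructor
  · intro h
    have key : ∀ y, Relation.ReflTransGen (edgeRel (mapVerts f E)) (f a) y →
        ∃ c, f c = y ∧ Relation.ReflTransGen (edgeRel E) a c := by
      intro y hy
      induction hy with
      | refl => exact ⟨a, rfl, .refl⟩
      | tail _ hstep ih =>
        obtain ⟨c, rfl, hc⟩ := ih
        obtain ⟨c', hc', hr⟩ := (edgeRel_mapVerts f).1 hstep
        exact ⟨c', hc', hc.tail hr⟩
    obtain ⟨c, hc, hr⟩ := key _ h
    rwa [← f.injective hc]
  · exact fun h => h.lift f fun c c' hc => (edgeRel_mapVerts f).2 ⟨c', rfl, hc⟩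

lemma mapVerts_mem_treesOn {s : ℕ} {E : Finset (Finset (Fin n))} :
    mapVerts f E ∈ treesOn s (Finset.univ.map f) ↔ E ∈ treesOn s Finset.univ := by
  rw [mem_treesOn, mem_treesOn]
  refine and_congr ?_ (and_congr ?_ ?_)
  · simp [mapVerts, Finset.map_subset_map]
  · simp [reflTransGen_mapVerts f]
  · simp [mapVerts]

lemma treesOn_map (s : ℕ) :
    treesOn s (Finset.univ.map f) =
      (treesOn s Finset.univ).map ⟨mapVerts f, Finset.map_injective _⟩ := by
  ext E
  rw [Finset.mem_map]
  constructor
  · intro hE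
    have h : mapVerts f (Finset.univ.filter fun e => e.map f ∈ E) = E := by
      ext e
      simp only [mem_mapVerts, Finset.mem_filter, Finset.mem_univ, true_and]
      constructor
      · rintro ⟨e', he', rfl⟩
        exact he'
      · intro he
        obtain ⟨e', _, rfl⟩ := Finset.subset_map_iff.1 ((mem_treesOn.1 hE).1 e he).2
        exact ⟨e', he, rfl⟩
    exact ⟨_, (mapVerts_mem_treesOn f).1 (h.symm ▸ hE), h⟩
  · rintro ⟨E', hE', rfl⟩
    exact (mapVerts_mem_treesOn f).2 hE'

lemma BE_mapVerts (E : Finset (Finset (Fin n))) (X : Finset (Fin N) → ℝ × ℝ) :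
    BE (mapVerts f E) X = BE E fun e => X (e.map f) := by
  induction E using Finset.induction_on with
  | empty => simp [BE, mapVerts]
  | insert e E he ih =>
    have h1 : mapVerts f (insert e E) = insert (e.map f) (mapVerts f E) := by
      simp [mapVerts, Finset.map_insert]
    have h2 : e.map f ∉ mapVerts f E := by
      rw [mem_mapVerts]
      rintro ⟨e', he', h⟩
      exact he (Finset.map_injective f h ▸ he')
    rw [h1, BE_insert _ _ _ h2, BE_insert _ _ _ he, ih]
    congr 1
    rw [mapVerts, Finset.prod_map]
    refine Finset.prod_congr rfl fun e' _ => ?_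
    simp [pairSign, ← Finset.map_inter]

lemma bTr_mapVerts (E : Finset (Finset (Fin n))) (r : Fin n) (x : ℝ × ℝ) :
    bTr (mapVerts f E) (f r) x = bTr E r x := by
  rw [bTr_eq, bTr_eq, ← integral_pi_comp_of_injective (Finset.map_injective f)
    (F := fun X => weight E r x X) ((measurable_weight E r).comp measurable_prodMk_left)]
  congr 1
  ext X
  rw [weight, weight, BE_mapVerts]
  congr 1
  rw [mapVerts, Finset.filter_map, Finset.prod_map]
  simp [Function.comp_def]

end Transport

/-- The sum of `b_{T,r}(x)` over all rooted hypertrees with `n` labelled vertices. -/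
def rootedSum (s n : ℕ) (x : ℝ × ℝ) : ℝ :=
  ∑ E ∈ treesOn s (Finset.univ : Finset (Fin n)), ∑ r, bTr E r x

lemma sum_treesOn_bTr {N : ℕ} (s : ℕ) (S : Finset (Fin N)) (x : ℝ × ℝ) :
    ∑ t ∈ S ×ˢ treesOn s S, bTr t.2 t.1 x = rootedSum s S.card x := by
  have hS : S = Finset.univ.map (S.orderEmbOfFin rfl).toEmbedding := by simp
  rw [Finset.sum_product_right, rootedSum]
  conv_lhs => rw [hS]
  rw [treesOn_map, Finset.sum_map]
  refine Finset.sum_congr rfl fun E _ => ?_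
  rw [Finset.sum_map]
  exact Finset.sum_congr rfl fun r _ => bTr_mapVerts _ E r x

lemma measurable_rootedSum (s n : ℕ) : Measurable (rootedSum s n) :=
  Finset.measurable_sum _ fun _ _ => Finset.measurable_sum _ fun _ _ => measurable_bTr _ _

lemma abs_rootedSum_le (s n : ℕ) (x : ℝ × ℝ) :
    |rootedSum s n x| ≤ (treesOn s (Finset.univ : Finset (Fin n))).card * n := by
  refine (Finset.abs_sum_le_sum_abs _ _).trans ?_
  rw [← nsmul_eq_mul]
  refine Finset.sum_le_card_nsmul _ _ _ fun E _ => (Finset.abs_sum_le_sum_abs _ _).trans ?_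
  simpa using Finset.sum_le_card_nsmul Finset.univ _ (1 : ℝ) fun r _ => abs_bTr_le E r x

lemma rootedSum_zero (s : ℕ) (x : ℝ × ℝ) : rootedSum s 0 x = 0 := by
  simp [rootedSum]

/-- The contribution to the recursion of a root of degree `d` whose subtrees are counted
by `f`. -/
def starIntegral {d s : ℕ} (x : ℝ × ℝ) (f : Fin d × Fin s → ℝ × ℝ → ℝ) : ℝ :=
  ∫ y : Fin d → ℝ × ℝ, starWeight d x y * ∏ k, f k (y k.1) ∂(Measure.pi fun _ => nu)

lemma integrable_star {d s : ℕ} (x : ℝ × ℝ) {f : Fin d × Fin s → ℝ × ℝ → ℝ}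
    (hf : ∀ k, Measurable (f k)) {C : Fin d × Fin s → ℝ} (hC : ∀ k y, |f k y| ≤ C k) :
    Integrable (fun y : Fin d → ℝ × ℝ => starWeight d x y * ∏ k, f k (y k.1))
      (Measure.pi fun _ => nu) := by
  have hm : Measurable fun y : Fin d → ℝ × ℝ => starWeight d x y * ∏ k, f k (y k.1) :=
    (measurable_starWeight d x).mul
      (Finset.measurable_prod _ fun k _ => (hf k).comp (measurable_pi_apply k.1))
  refine Integrable.of_bound hm.aestronglyMeasurable (∏ k, C k)
    (Filter.Eventually.of_forall fun y => ?_)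
  rw [Real.norm_eq_abs, abs_mul, abs_starWeight, one_mul, Finset.abs_prod]
  exact Finset.prod_le_prod (fun _ _ => abs_nonneg _) fun k _ => hC k _

lemma abs_starIntegral_le {d s : ℕ} (x : ℝ × ℝ) {f : Fin d × Fin s → ℝ × ℝ → ℝ}
    {C : Fin d × Fin s → ℝ} (hC : ∀ k y, |f k y| ≤ C k) :
    |starIntegral x f| ≤ ∏ k, C k := by
  have := norm_integral_le_of_norm_le_const (μ := Measure.pi fun _ : Fin d => nu)
    (f := fun y => starWeight d x y * ∏ k, f k (y k.1)) (C := ∏ k, C k)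
    (Filter.Eventually.of_forall fun y => by
      rw [Real.norm_eq_abs, abs_mul, abs_starWeight, one_mul, Finset.abs_prod]
      exact Finset.prod_le_prod (fun _ _ => abs_nonneg _) fun k _ => hC k _)
  simpa [starIntegral] using this

lemma sum_pieces_bTr {N d s : ℕ} (hs : 1 ≤ s) (r : Fin N)
    (c : {v : Fin N // v ≠ r} → Fin d × Fin s) (x : ℝ × ℝ) :
    ∑ p ∈ pieces r c, bTr (glue r p) r x =
      starIntegral x fun k => rootedSum s (block r c k).card := by
  rw [Finset.sum_congr rfl fun p hp => (isPieces_of_mem hp).bTr_glue hs x,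
    ← integral_finsetSum]
  · refine integral_congr_ae (Filter.Eventually.of_forall fun y => ?_)
    simp only
    rw [← Finset.mul_sum]
    congr 1
    simp only [← sum_treesOn_bTr]
    rw [Finset.prod_univ_sum]
    rfl
  · intro p _
    exact integrable_star (f := fun k y => bTr (p k).2 (p k).1 y) x (fun k => measurable_bTr _ _)
      (C := fun _ => 1) fun k y => abs_bTr_le _ _ _

lemma rootedSum_succ {s : ℕ} (hs : 1 ≤ s) (n : ℕ) (x : ℝ × ℝ) :
    rootedSum s (n + 1) x = (n + 1) * ∑ d ∈ Finset.range (n + 1),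
      ((d.factorial * s.factorial ^ d : ℕ) : ℝ)⁻¹ *
        ∑ m ∈ Finset.piAntidiag (Finset.univ : Finset (Fin d × Fin s)) n,
          (Nat.multinomial Finset.univ m : ℝ) *
            starIntegral x fun k => rootedSum s (m k) := by
  rw [rootedSum, Finset.sum_comm]
  have h : ∀ r : Fin (n + 1), ∑ E ∈ treesOn s (Finset.univ : Finset (Fin (n + 1))), bTr E r x =
      ∑ d ∈ Finset.range (n + 1), ((d.factorial * s.factorial ^ d : ℕ) : ℝ)⁻¹ *
        ∑ m ∈ Finset.piAntidiag (Finset.univ : Finset (Fin d × Fin s)) n,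
          (Nat.multinomial Finset.univ m : ℝ) *
            starIntegral x fun k => rootedSum s (m k) := by
    intro r
    rw [sum_treesOn_eq hs r]
    refine Finset.sum_congr rfl fun d _ => ?_
    congr 1
    have hcard : Fintype.card {v : Fin (n + 1) // v ≠ r} = n := by simp
    rw [Finset.sum_congr rfl fun c _ => sum_pieces_bTr hs r c x]
    have := sum_card_fiber (W := {v : Fin (n + 1) // v ≠ r}) (κ := Fin d × Fin s)
      fun m => starIntegral x fun k => rootedSum s (m k)
    rw [hcard] at this
    rw [← this]
    refine Finset.sum_congr rfl fun c _ => ?_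
    simp only [block, Finset.card_map]
  rw [Finset.sum_congr rfl fun r _ => h r]
  simp

/-- The coefficient of `z ^ n` in the tree expansion. -/
def coeff (s n : ℕ) (x : ℝ × ℝ) : ℝ := rootedSum s n x / n.factorial

lemma coeff_zero (s : ℕ) (x : ℝ × ℝ) : coeff s 0 x = 0 := by
  simp [coeff, rootedSum_zero]

lemma measurable_coeff (s n : ℕ) : Measurable (coeff s n) :=
  (measurable_rootedSum s n).div_const _

lemma coeff_succ {s : ℕ} (hs : 1 ≤ s) (n : ℕ) (x : ℝ × ℝ) :
    coeff s (n + 1) x = ∑ d ∈ Finset.range (n + 1),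
      ((d.factorial * s.factorial ^ d : ℕ) : ℝ)⁻¹ *
        ∑ m ∈ Finset.piAntidiag (Finset.univ : Finset (Fin d × Fin s)) n,
          starIntegral x fun k => coeff s (m k) := by
  have h : ∀ d, ∀ m ∈ Finset.piAntidiag (Finset.univ : Finset (Fin d × Fin s)) n,
      (Nat.multinomial Finset.univ m : ℝ) * starIntegral x (fun k => rootedSum s (m k)) =
        n.factorial * starIntegral x fun k => coeff s (m k) := by
    intro d m hm
    have hsum : ∑ k, m k = n := (Finset.mem_piAntidiag.1 hm).1
    have hspec : ((∏ k, (m k).factorial : ℕ) : ℝ) * Nat.multinomial Finset.univ m =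
        n.factorial := by
      rw [← hsum]
      exact_mod_cast Nat.multinomial_spec Finset.univ m
    rw [← hspec]
    simp only [starIntegral, coeff, Finset.prod_div_distrib, ← mul_div_assoc, integral_div]
    have : ((∏ k, (m k).factorial : ℕ) : ℝ) ≠ 0 := by
      exact_mod_cast (Finset.prod_pos fun k _ => Nat.factorial_pos _).ne'
    push_cast at this ⊢
    field_simp
  rw [coeff, rootedSum_succ hs, Finset.sum_congr rfl fun d _ => by
    rw [Finset.sum_congr rfl (h d), ← Finset.mul_sum, mul_left_comm], ← Finset.mul_sum,
    Nat.factorial_succ]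
  have : (n.factorial : ℝ) ≠ 0 := by positivity
  have : (n : ℝ) + 1 ≠ 0 := by positivity
  push_cast
  field_simp

/-- The weight of the degree `d` of the root in the recursion for `coeff`. -/
def degWeight (s d : ℕ) : ℝ := ((d.factorial * s.factorial ^ d : ℕ) : ℝ)⁻¹

lemma degWeight_nonneg (s d : ℕ) : 0 ≤ degWeight s d := by unfold degWeight; positivity

lemma degWeight_le (s d : ℕ) : degWeight s d ≤ (d.factorial : ℝ)⁻¹ := by
  unfold degWeight
  refine inv_anti₀ (by positivity) ?_
  exact_mod_cast Nat.le_mul_of_pos_right _ (pow_pos (Nat.factorial_pos s) d)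

lemma degWeight_mul_le (s d : ℕ) :
    degWeight s (d + 1) * (((d + 1) * s : ℕ) : ℝ) ≤ (d.factorial : ℝ)⁻¹ := by
  unfold degWeight
  rw [inv_mul_le_iff₀ (by positivity), ← div_eq_mul_inv, le_div_iff₀ (by positivity)]
  have h : s ≤ s.factorial ^ (d + 1) :=
    (Nat.self_le_factorial s).trans (Nat.le_self_pow (by omega) _)
  have : (d + 1) * s * d.factorial ≤ (d + 1).factorial * s.factorial ^ (d + 1) := by
    rw [Nat.factorial_succ]
    calc (d + 1) * s * d.factorial = (d + 1) * d.factorial * s := by ring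
      _ ≤ _ := Nat.mul_le_mul_left _ h
  exact_mod_cast this

lemma sum_inv_factorial_le (D : ℕ) :
    ∑ d ∈ Finset.range D, (d.factorial : ℝ)⁻¹ ≤ Real.exp 1 := by
  simpa using Real.sum_le_exp_of_nonneg zero_le_one D

lemma sum_degWeight_le (s D : ℕ) : ∑ d ∈ Finset.range D, degWeight s d ≤ Real.exp 1 :=
  (Finset.sum_le_sum fun d _ => degWeight_le s d).trans (sum_inv_factorial_le D)

lemma sum_degWeight_mul_le (s D : ℕ) :
    ∑ d ∈ Finset.range D, degWeight s d * ((d * s : ℕ) : ℝ) ≤ Real.exp 1 := by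
  cases D with
  | zero => simpa using (Real.exp_pos 1).le
  | succ D =>
    rw [Finset.sum_range_succ']
    simp only [zero_mul, Nat.cast_zero, mul_zero, add_zero]
    exact (Finset.sum_le_sum fun d _ => degWeight_mul_le s d).trans (sum_inv_factorial_le D)

lemma coeff_succ_of_lt {s : ℕ} (hs : 1 ≤ s) {n D : ℕ} (hD : n < D) (x : ℝ × ℝ) :
    coeff s (n + 1) x = ∑ d ∈ Finset.range D, degWeight s d *
        ∑ m ∈ Finset.piAntidiag (Finset.univ : Finset (Fin d × Fin s)) n,
          starIntegral x fun k => coeff s (m k) := by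
  rw [coeff_succ hs]
  refine Finset.sum_subset (Finset.range_subset_range.2 hD) fun d _ hd => ?_
  rw [Finset.sum_eq_zero, mul_zero]
  intro m hm
  have hsum : ∑ k, m k = n := (Finset.mem_piAntidiag.1 hm).1
  obtain ⟨k, hk⟩ : ∃ k, m k = 0 := by
    by_contra! h
    have h1 := Finset.card_nsmul_le_sum Finset.univ m 1 fun k _ => Nat.one_le_iff_ne_zero.2 (h k)
    simp only [Finset.card_univ, Fintype.card_prod, Fintype.card_fin, smul_eq_mul, mul_one,
      hsum] at h1
    rw [Finset.mem_range, not_lt] at hd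
    have := Nat.le_mul_of_pos_right d hs
    omega
  unfold starIntegral
  rw [← integral_zero (Fin d → ℝ × ℝ) ℝ (μ := Measure.pi fun _ => nu)]
  congr 1
  ext y
  rw [Finset.prod_eq_zero (Finset.mem_univ k) (by simp [hk, coeff_zero]), mul_zero]

/-- The supremum of the `n`-th coefficient. -/
def coeffSup (s n : ℕ) : ℝ := ⨆ x, |coeff s n x|

lemma abs_coeff_le (s n : ℕ) (x : ℝ × ℝ) : |coeff s n x| ≤ coeffSup s n := by
  refine le_ciSup (f := fun x => |coeff s n x|)
    ⟨(treesOn s (Finset.univ : Finset (Fin n))).card * n / n.factorial, ?_⟩ x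
  rintro _ ⟨y, rfl⟩
  simp only [coeff, abs_div, Nat.abs_cast]
  gcongr
  exact abs_rootedSum_le s n y

lemma coeffSup_nonneg (s n : ℕ) : 0 ≤ coeffSup s n :=
  (abs_nonneg _).trans (abs_coeff_le s n (0, 0))

lemma coeffSup_zero (s : ℕ) : coeffSup s 0 = 0 := by
  simp [coeffSup, coeff_zero]

lemma abs_starIntegral_coeff_le {d s : ℕ} (x : ℝ × ℝ) (m : Fin d × Fin s → ℕ) :
    |starIntegral x fun k => coeff s (m k)| ≤ ∏ k, coeffSup s (m k) :=
  abs_starIntegral_le x fun k y => abs_coeff_le s (m k) y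

lemma coeffSup_succ_le {s : ℕ} (hs : 1 ≤ s) {n D : ℕ} (hD : n < D) :
    coeffSup s (n + 1) ≤ ∑ d ∈ Finset.range D, degWeight s d *
        ∑ m ∈ Finset.piAntidiag (Finset.univ : Finset (Fin d × Fin s)) n,
          ∏ k, coeffSup s (m k) := by
  refine ciSup_le fun x => ?_
  rw [coeff_succ_of_lt hs hD]
  refine (Finset.abs_sum_le_sum_abs _ _).trans (Finset.sum_le_sum fun d _ => ?_)
  rw [abs_mul, abs_of_nonneg (degWeight_nonneg s d)]
  refine mul_le_mul_of_nonneg_left ?_ (degWeight_nonneg s d)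
  exact (Finset.abs_sum_le_sum_abs _ _).trans
    (Finset.sum_le_sum fun m _ => abs_starIntegral_coeff_le x m)

lemma sum_piFinset_range {κ M : Type*} [Fintype κ] [DecidableEq κ] [AddCommMonoid M] (N : ℕ)
    (F : (κ → ℕ) → M) :
    ∑ m ∈ Fintype.piFinset fun _ : κ => Finset.range (N + 1), F m =
      ∑ n ∈ Finset.range (N + 1), ∑ m ∈ Finset.piAntidiag Finset.univ n, F m +
      ∑ m ∈ (Fintype.piFinset fun _ : κ => Finset.range (N + 1)).filter (fun m => N < ∑ k, m k),
        F m := by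
  rw [← Finset.sum_filter_not_add_sum_filter _ (fun m : κ → ℕ => N < ∑ k, m k)]
  congr 1
  rw [← Finset.sum_fiberwise_of_maps_to (t := Finset.range (N + 1)) (g := fun m => ∑ k, m k)]
  · refine Finset.sum_congr rfl fun n hn => Finset.sum_congr ?_ fun _ _ => rfl
    rw [Finset.mem_range] at hn
    ext m
    simp only [Finset.mem_filter, Fintype.mem_piFinset, Finset.mem_range, not_lt,
      Finset.mem_piAntidiag, Finset.mem_univ, implies_true, and_true]
    constructor
    · exact fun h => h.2
    · intro h
      replace h : ∑ k, m k = n := h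
      refine ⟨⟨fun k => ?_, by omega⟩, h⟩
      have : m k ≤ ∑ k, m k :=
        Finset.single_le_sum (fun _ _ => Nat.zero_le _) (Finset.mem_univ k)
      omega
  · intro m hm
    have := (Finset.mem_filter.1 hm).2
    rw [Finset.mem_range]
    omega

lemma sum_piFinset_prod_pow {κ : Type*} [Fintype κ] [DecidableEq κ] (N : ℕ) (f : ℕ → ℝ) :
    ∑ m ∈ Fintype.piFinset fun _ : κ => Finset.range (N + 1), ∏ k, f (m k) =
      (∑ n ∈ Finset.range (N + 1), f n) ^ Fintype.card κ := by
  rw [← Finset.prod_univ_sum]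
  simp

lemma sum_coeffSup_le_one {s : ℕ} (hs : 1 ≤ s) (N : ℕ) :
    ∑ n ∈ Finset.range (N + 1), coeffSup s n * Real.exp (-1) ^ n ≤ 1 := by
  induction N with
  | zero => simp [coeffSup_zero]
  | succ N ih =>
    set f : ℕ → ℝ := fun n => coeffSup s n * Real.exp (-1) ^ n with hf
    have hf0 : ∀ n, 0 ≤ f n := fun n => mul_nonneg (coeffSup_nonneg s n) (by positivity)
    have h1 : ∀ n ∈ Finset.range (N + 1), f (n + 1) ≤ Real.exp (-1) *
        ∑ d ∈ Finset.range (N + 1), degWeight s d *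
          ∑ m ∈ Finset.piAntidiag (Finset.univ : Finset (Fin d × Fin s)) n,
            ∏ k, f (m k) := by
      intro n hn
      have h2 : ∀ d, ∑ m ∈ Finset.piAntidiag (Finset.univ : Finset (Fin d × Fin s)) n,
          ∏ k, f (m k) = (∑ m ∈ Finset.piAntidiag (Finset.univ : Finset (Fin d × Fin s)) n,
            ∏ k, coeffSup s (m k)) * Real.exp (-1) ^ n := by
        intro d
        rw [Finset.sum_mul]
        refine Finset.sum_congr rfl fun m hm => ?_
        rw [Finset.prod_mul_distrib, Finset.prod_pow_eq_pow_sum, (Finset.mem_piAntidiag.1 hm).1]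
      simp only [h2, ← mul_assoc, ← Finset.sum_mul]
      rw [hf, mul_assoc, mul_comm (Real.exp (-1)), mul_assoc, ← pow_succ]
      exact mul_le_mul_of_nonneg_right (coeffSup_succ_le hs (Finset.mem_range.1 hn))
        (by positivity)
    have h3 : ∀ d, ∑ n ∈ Finset.range (N + 1),
        ∑ m ∈ Finset.piAntidiag (Finset.univ : Finset (Fin d × Fin s)) n, ∏ k, f (m k) ≤ 1 := by
      intro d
      have h4 := sum_piFinset_range (κ := Fin d × Fin s) N fun m => ∏ k, f (m k)
      rw [sum_piFinset_prod_pow] at h4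
      have h5 : (∑ n ∈ Finset.range (N + 1), f n) ^ Fintype.card (Fin d × Fin s) ≤ 1 :=
        pow_le_one₀ (Finset.sum_nonneg fun n _ => hf0 n) ih
      have h6 : 0 ≤ ∑ m ∈ (Fintype.piFinset fun _ : Fin d × Fin s =>
          Finset.range (N + 1)).filter (fun m => N < ∑ k, m k), ∏ k, f (m k) :=
        Finset.sum_nonneg fun m _ => Finset.prod_nonneg fun k _ => hf0 _
      linarith
    rw [Finset.sum_range_succ']
    have hzero : f 0 = 0 := by simp [hf, coeffSup_zero]
    calc ∑ n ∈ Finset.range (N + 1), f (n + 1) + f 0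
        = ∑ n ∈ Finset.range (N + 1), f (n + 1) := by rw [hzero, add_zero]
      _ ≤ _ := Finset.sum_le_sum h1
      _ = Real.exp (-1) * ∑ d ∈ Finset.range (N + 1), degWeight s d *
          ∑ n ∈ Finset.range (N + 1),
            ∑ m ∈ Finset.piAntidiag (Finset.univ : Finset (Fin d × Fin s)) n,
              ∏ k, f (m k) := by
        rw [← Finset.mul_sum, Finset.sum_comm]
        simp only [Finset.mul_sum]
      _ ≤ Real.exp (-1) * ∑ d ∈ Finset.range (N + 1), degWeight s d * 1 := by
        gcongr with d _
        · exact degWeight_nonneg s d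
        · exact h3 d
      _ ≤ Real.exp (-1) * Real.exp 1 := by
        simp only [mul_one]
        gcongr
        exact sum_degWeight_le s _
      _ = 1 := by rw [← Real.exp_add]; simp

lemma Tterm_succ_eq (s : ℕ) (G : ℂ → ℝ × ℝ → ℂ) (z : ℂ) (x : ℝ × ℝ) (d : ℕ) :
    Tterm (s + 1) G z x d = (degWeight s d : ℂ) *
      ∫ y : Fin d → ℝ × ℝ, (starWeight d x y : ℂ) * ∏ k : Fin d × Fin s, G z (y k.1)
        ∂(Measure.pi fun _ => nu) := by
  have h : ∀ y : Fin d → ℝ × ℝ,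
      (∏ i, ((K x (y i) : ℂ) * G z (y i) ^ (s + 1 - 1) / ((s + 1 - 1).factorial : ℂ))) *
        (pairProd d y : ℂ) = ((s.factorial : ℂ) ^ d)⁻¹ *
      ((starWeight d x y : ℂ) * ∏ k : Fin d × Fin s, G z (y k.1)) := by
    intro y
    rw [Fintype.prod_prod_type]
    simp only [starWeight, Nat.add_sub_cancel, Finset.prod_div_distrib, Finset.prod_mul_distrib,
      Finset.prod_const, Finset.card_univ, Fintype.card_fin]
    push_cast
    ring
  unfold Tterm degWeight
  simp only [h]
  rw [integral_const_mul]
  push_cast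
  rw [mul_inv, mul_assoc]

lemma norm_starWeight (d : ℕ) (x : ℝ × ℝ) (y : Fin d → ℝ × ℝ) : ‖(starWeight d x y : ℂ)‖ = 1 := by
  rw [Complex.norm_real, Real.norm_eq_abs, abs_starWeight]

lemma norm_prod_sub_prod_le {ι : Type*} (A : Finset ι) {f g : ι → ℂ} {ε : ℝ}
    (hf : ∀ i ∈ A, ‖f i‖ ≤ 1) (hg : ∀ i ∈ A, ‖g i‖ ≤ 1) (hε : ∀ i ∈ A, ‖f i - g i‖ ≤ ε) :
    ‖∏ i ∈ A, f i - ∏ i ∈ A, g i‖ ≤ A.card * ε := by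
  induction A using Finset.induction_on with
  | empty => simp
  | insert a A ha ih =>
    simp only [Finset.forall_mem_insert] at hf hg hε
    rw [Finset.prod_insert ha, Finset.prod_insert ha, Finset.card_insert_of_notMem ha]
    have h1 : ‖∏ i ∈ A, g i‖ ≤ 1 := by
      rw [norm_prod]
      exact Finset.prod_le_one (fun _ _ => norm_nonneg _) hg.2
    calc ‖f a * ∏ i ∈ A, f i - g a * ∏ i ∈ A, g i‖
        = ‖f a * (∏ i ∈ A, f i - ∏ i ∈ A, g i) + (f a - g a) * ∏ i ∈ A, g i‖ := by ring_nf
      _ ≤ 1 * (A.card * ε) + ε * 1 := by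
        refine (norm_add_le _ _).trans (add_le_add ?_ ?_)
        · rw [norm_mul]
          exact mul_le_mul hf.1 (ih hf.2 hg.2 hε.2) (norm_nonneg _) zero_le_one
        · rw [norm_mul]
          exact mul_le_mul hε.1 h1 (norm_nonneg _) ((norm_nonneg _).trans hε.1)
      _ = ((A.card + 1 : ℕ) : ℝ) * ε := by push_cast; ring

lemma ae_mem_Omega (d : ℕ) :
    ∀ᵐ y : Fin d → ℝ × ℝ ∂(Measure.pi fun _ => nu), ∀ i, y i ∈ Omega := by
  refine eventually_all.2 fun i => ?_
  have h : ∀ᵐ x ∂nu, x ∈ Omega := by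
    have := ae_restrict_mem (μ := nu) measurableSet_Omega
    rwa [nu_restrict] at this
  exact (Measure.quasiMeasurePreserving_eval (fun _ : Fin d => nu) i).ae h

section Star

variable {d s : ℕ} (x : ℝ × ℝ) {G : ℝ × ℝ → ℂ}

lemma ae_norm_star_le (hG1 : ∀ y ∈ Omega, ‖G y‖ ≤ 1) :
    ∀ᵐ y : Fin d → ℝ × ℝ ∂(Measure.pi fun _ => nu),
      ‖(starWeight d x y : ℂ) * ∏ k : Fin d × Fin s, G (y k.1)‖ ≤ 1 := by
  filter_upwards [ae_mem_Omega d] with y hy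
  rw [norm_mul, norm_starWeight, one_mul, norm_prod]
  exact Finset.prod_le_one (fun _ _ => norm_nonneg _) fun k _ => hG1 _ (hy _)

lemma norm_integral_star_le (hG1 : ∀ y ∈ Omega, ‖G y‖ ≤ 1) :
    ‖∫ y : Fin d → ℝ × ℝ, (starWeight d x y : ℂ) * ∏ k : Fin d × Fin s, G (y k.1)
      ∂(Measure.pi fun _ => nu)‖ ≤ 1 := by
  simpa using norm_integral_le_of_norm_le_const (ae_norm_star_le (s := s) x hG1)

lemma integrable_complex_star (hG : AEStronglyMeasurable G nu) (hG1 : ∀ y ∈ Omega, ‖G y‖ ≤ 1) :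
    Integrable (fun y : Fin d → ℝ × ℝ => (starWeight d x y : ℂ) * ∏ k : Fin d × Fin s, G (y k.1))
      (Measure.pi fun _ => nu) := by
  refine Integrable.of_bound (AEStronglyMeasurable.mul ?_ ?_) 1 (ae_norm_star_le x hG1)
  · exact (Complex.measurable_ofReal.comp (measurable_starWeight d x)).aestronglyMeasurable
  · exact Finset.aestronglyMeasurable_fun_prod _ fun k _ =>
      hG.comp_quasiMeasurePreserving (Measure.quasiMeasurePreserving_eval _ k.1)

lemma norm_integral_star_sub_le {F : ℝ × ℝ → ℂ} (hG : AEStronglyMeasurable G nu)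
    (hG1 : ∀ y ∈ Omega, ‖G y‖ ≤ 1) (hF : AEStronglyMeasurable F nu)
    (hF1 : ∀ y ∈ Omega, ‖F y‖ ≤ 1) {ε : ℝ} (hε : ∀ y ∈ Omega, ‖G y - F y‖ ≤ ε) :
    ‖(∫ y : Fin d → ℝ × ℝ, (starWeight d x y : ℂ) * ∏ k : Fin d × Fin s, G (y k.1)
        ∂(Measure.pi fun _ => nu)) -
      ∫ y : Fin d → ℝ × ℝ, (starWeight d x y : ℂ) * ∏ k : Fin d × Fin s, F (y k.1)
        ∂(Measure.pi fun _ => nu)‖ ≤ ((d * s : ℕ) : ℝ) * ε := by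
  rw [← integral_sub (integrable_complex_star x hG hG1) (integrable_complex_star x hF hF1)]
  have h : ∀ᵐ y : Fin d → ℝ × ℝ ∂(Measure.pi fun _ => nu),
      ‖(starWeight d x y : ℂ) * ∏ k : Fin d × Fin s, G (y k.1) -
        (starWeight d x y : ℂ) * ∏ k : Fin d × Fin s, F (y k.1)‖ ≤ ((d * s : ℕ) : ℝ) * ε := by
    filter_upwards [ae_mem_Omega d] with y hy
    rw [← mul_sub, norm_mul, norm_starWeight, one_mul]
    simpa using norm_prod_sub_prod_le (Finset.univ : Finset (Fin d × Fin s))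
      (fun k _ => hG1 _ (hy k.1)) (fun k _ => hF1 _ (hy k.1)) fun k _ => hε _ (hy k.1)
  simpa using norm_integral_le_of_norm_le_const h

end Star

/-- The partial sums of the tree expansion. -/
def partialSum (s N : ℕ) (z : ℂ) (x : ℝ × ℝ) : ℂ :=
  ∑ n ∈ Finset.range (N + 1), (coeff s n x : ℂ) * z ^ n

lemma measurable_partialSum (s N : ℕ) (z : ℂ) : Measurable (partialSum s N z) :=
  Finset.measurable_sum _ fun n _ =>
    (Complex.measurable_ofReal.comp (measurable_coeff s n)).mul_const _

lemma norm_partialSum_le_one {s : ℕ} (hs : 1 ≤ s) (N : ℕ) {z : ℂ} (hz : ‖z‖ ≤ Real.exp (-1))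
    (x : ℝ × ℝ) : ‖partialSum s N z x‖ ≤ 1 := by
  refine (norm_sum_le _ _).trans ((Finset.sum_le_sum fun n _ => ?_).trans
    (sum_coeffSup_le_one hs N))
  rw [norm_mul, norm_pow, Complex.norm_real, Real.norm_eq_abs]
  exact mul_le_mul (abs_coeff_le s n x) (pow_le_pow_left₀ (norm_nonneg _) hz n) (by positivity)
    (coeffSup_nonneg s n)

lemma integral_star_partialSum (s N d : ℕ) (z : ℂ) (x : ℝ × ℝ) :
    ∫ y : Fin d → ℝ × ℝ, (starWeight d x y : ℂ) * ∏ k : Fin d × Fin s, partialSum s N z (y k.1)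
        ∂(Measure.pi fun _ => nu) =
      ∑ m ∈ Fintype.piFinset fun _ : Fin d × Fin s => Finset.range (N + 1),
        z ^ (∑ k, m k) * (starIntegral x (fun k => coeff s (m k)) : ℂ) := by
  have h : ∀ y : Fin d → ℝ × ℝ,
      (starWeight d x y : ℂ) * ∏ k : Fin d × Fin s, partialSum s N z (y k.1) =
      ∑ m ∈ Fintype.piFinset fun _ : Fin d × Fin s => Finset.range (N + 1),
        z ^ (∑ k, m k) * ((starWeight d x y * ∏ k, coeff s (m k) (y k.1) : ℝ) : ℂ) := by
    intro y
    simp only [partialSum]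
    rw [Finset.prod_univ_sum, Finset.mul_sum]
    refine Finset.sum_congr rfl fun m _ => ?_
    rw [Finset.prod_mul_distrib, Finset.prod_pow_eq_pow_sum]
    push_cast
    ring
  simp only [h]
  rw [integral_finsetSum]
  · refine Finset.sum_congr rfl fun m _ => ?_
    rw [integral_const_mul, integral_complex_ofReal, starIntegral]
  · intro m _
    exact (integrable_star x (f := fun k => coeff s (m k)) (fun k => measurable_coeff s (m k))
      (fun k y => abs_coeff_le s (m k) y)).ofReal.const_mul _

lemma partialSum_succ {s : ℕ} (hs : 1 ≤ s) {N D : ℕ} (hD : N < D) (z : ℂ) (x : ℝ × ℝ) :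
    partialSum s (N + 1) z x = z * ∑ d ∈ Finset.range D, (degWeight s d : ℂ) *
      ∑ n ∈ Finset.range (N + 1),
        ∑ m ∈ Finset.piAntidiag (Finset.univ : Finset (Fin d × Fin s)) n,
          z ^ (∑ k, m k) * (starIntegral x (fun k => coeff s (m k)) : ℂ) := by
  rw [partialSum, Finset.sum_range_succ', coeff_zero]
  simp only [Finset.mul_sum, Complex.ofReal_zero, zero_mul, add_zero]
  rw [Finset.sum_comm]
  refine Finset.sum_congr rfl fun n hn => ?_
  rw [coeff_succ_of_lt hs (lt_of_le_of_lt (Nat.lt_succ_iff.1 (Finset.mem_range.1 hn)) hD)]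
  push_cast
  rw [Finset.sum_mul]
  refine Finset.sum_congr rfl fun d _ => ?_
  rw [Finset.mul_sum, Finset.sum_mul]
  refine Finset.sum_congr rfl fun m hm => ?_
  rw [(Finset.mem_piAntidiag.1 hm).1]
  ring

lemma exp_neg_two_le : Real.exp (-2) ≤ Real.exp (-1) := Real.exp_le_exp.2 (by norm_num)

lemma norm_partialSum_error_le {s : ℕ} (hs : 1 ≤ s) {N D : ℕ} (hD : N < D) {z : ℂ}
    (hz : ‖z‖ ≤ Real.exp (-2)) (x : ℝ × ℝ) :
    ‖z * ∑ d ∈ Finset.range D, (degWeight s d : ℂ) *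
        (∫ y : Fin d → ℝ × ℝ,
          (starWeight d x y : ℂ) * ∏ k : Fin d × Fin s, partialSum s N z (y k.1)
          ∂(Measure.pi fun _ => nu)) - partialSum s (N + 1) z x‖ ≤
      Real.exp (-1) * Real.exp (-1) ^ N := by
  have hsq : Real.exp (-2) = Real.exp (-1) * Real.exp (-1) := by
    rw [← Real.exp_add]; norm_num
  have htail : ∀ d, ‖∑ m ∈ (Fintype.piFinset fun _ : Fin d × Fin s =>
      Finset.range (N + 1)).filter (fun m => N < ∑ k, m k),
        z ^ (∑ k, m k) * (starIntegral x (fun k => coeff s (m k)) : ℂ)‖ ≤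
      Real.exp (-1) ^ N := by
    intro d
    have h1 : ∀ m ∈ (Fintype.piFinset fun _ : Fin d × Fin s =>
        Finset.range (N + 1)).filter (fun m => N < ∑ k, m k),
        ‖z ^ (∑ k, m k) * (starIntegral x (fun k => coeff s (m k)) : ℂ)‖ ≤
        Real.exp (-1) ^ N * ∏ k, (coeffSup s (m k) * Real.exp (-1) ^ m k) := by
      intro m hm
      have hm := (Finset.mem_filter.1 hm).2
      rw [Finset.prod_mul_distrib, Finset.prod_pow_eq_pow_sum, norm_mul, norm_pow,
        Complex.norm_real, Real.norm_eq_abs]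
      calc ‖z‖ ^ (∑ k, m k) * |starIntegral x fun k => coeff s (m k)|
          ≤ (Real.exp (-1) ^ N * Real.exp (-1) ^ (∑ k, m k)) * ∏ k, coeffSup s (m k) := by
            refine mul_le_mul ?_ (abs_starIntegral_coeff_le x m) (abs_nonneg _) (by positivity)
            refine (pow_le_pow_left₀ (norm_nonneg _) hz _).trans ?_
            rw [hsq, mul_pow]
            refine mul_le_mul_of_nonneg_right ?_ (by positivity)
            exact pow_le_pow_of_le_one (Real.exp_pos _).le
              (Real.exp_le_one_iff.2 (by norm_num)) hm.le
        _ = _ := by ring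
    have hf0 : ∀ n, 0 ≤ coeffSup s n * Real.exp (-1) ^ n :=
      fun n => mul_nonneg (coeffSup_nonneg s n) (by positivity)
    refine (norm_sum_le _ _).trans ((Finset.sum_le_sum h1).trans ?_)
    rw [← Finset.mul_sum]
    refine mul_le_of_le_one_right (by positivity) ?_
    refine (Finset.sum_le_sum_of_subset_of_nonneg (Finset.filter_subset _ _)
      fun m _ _ => Finset.prod_nonneg fun k _ => hf0 _).trans ?_
    rw [sum_piFinset_prod_pow N fun n => coeffSup s n * Real.exp (-1) ^ n]
    exact pow_le_one₀ (Finset.sum_nonneg fun n _ => hf0 n) (sum_coeffSup_le_one hs N)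
  rw [partialSum_succ hs hD, ← mul_sub, ← Finset.sum_sub_distrib, norm_mul]
  have hterm : ∀ d, ‖(degWeight s d : ℂ) *
        (∫ y : Fin d → ℝ × ℝ,
          (starWeight d x y : ℂ) * ∏ k : Fin d × Fin s, partialSum s N z (y k.1)
          ∂(Measure.pi fun _ => nu)) - (degWeight s d : ℂ) * ∑ n ∈ Finset.range (N + 1),
        ∑ m ∈ Finset.piAntidiag (Finset.univ : Finset (Fin d × Fin s)) n,
          z ^ (∑ k, m k) * (starIntegral x (fun k => coeff s (m k)) : ℂ)‖ ≤
      degWeight s d * Real.exp (-1) ^ N := by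
    intro d
    rw [← mul_sub, norm_mul, integral_star_partialSum, sum_piFinset_range, add_sub_cancel_left,
      Complex.norm_real, Real.norm_eq_abs, abs_of_nonneg (degWeight_nonneg s d)]
    exact mul_le_mul_of_nonneg_left (htail d) (degWeight_nonneg s d)
  calc _ ≤ Real.exp (-2) * ∑ d ∈ Finset.range D, degWeight s d * Real.exp (-1) ^ N :=
        mul_le_mul hz ((norm_sum_le _ _).trans (Finset.sum_le_sum fun d _ => hterm d))
          (norm_nonneg _) (Real.exp_pos _).le
    _ ≤ Real.exp (-2) * (Real.exp 1 * Real.exp (-1) ^ N) := by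
        rw [← Finset.sum_mul]
        gcongr
        exact sum_degWeight_le s D
    _ = Real.exp (-1) * Real.exp (-1) ^ N := by
        rw [← mul_assoc, ← Real.exp_add]; norm_num

lemma norm_Tterm_le (s : ℕ) {G : ℂ → ℝ × ℝ → ℂ} {z : ℂ} (hG1 : ∀ y ∈ Omega, ‖G z y‖ ≤ 1)
    (x : ℝ × ℝ) (d : ℕ) : ‖Tterm (s + 1) G z x d‖ ≤ (d.factorial : ℝ)⁻¹ := by
  rw [Tterm_succ_eq, norm_mul, Complex.norm_real, Real.norm_eq_abs,
    abs_of_nonneg (degWeight_nonneg s d)]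
  exact (mul_le_of_le_one_right (degWeight_nonneg s d) (norm_integral_star_le x hG1)).trans
    (degWeight_le s d)

lemma Tterm_zero (q : ℕ) (G : ℂ → ℝ × ℝ → ℂ) (z : ℂ) (x : ℝ × ℝ) : Tterm q G z x 0 = 1 := by
  simp [Tterm, pairProd]

lemma tendsto_Tcal (s : ℕ) {G : ℂ → ℝ × ℝ → ℂ} {z : ℂ} (hG1 : ∀ y ∈ Omega, ‖G z y‖ ≤ 1)
    (x : ℝ × ℝ) :
    Tendsto (fun D => z * ∑ d ∈ Finset.range D, Tterm (s + 1) G z x d) atTop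
      (nhds (Tcal (s + 1) G z x)) := by
  have hs : Summable (Tterm (s + 1) G z x) :=
    Summable.of_norm_bounded (by simpa using Real.summable_pow_div_factorial 1)
      (norm_Tterm_le s hG1 x)
  have h := hs.hasSum.tendsto_sum_nat.const_mul z
  rwa [hs.tsum_eq_zero_add, Tterm_zero, mul_add, mul_one] at h

lemma norm_sub_partialSum_succ_le {s : ℕ} (hs : 1 ≤ s) {H : ℂ → ℝ × ℝ → ℂ} {z : ℂ}
    (hz : ‖z‖ ≤ Real.exp (-2)) (hm : AEStronglyMeasurable (H z) nu)
    (hH1 : ∀ y ∈ Omega, ‖H z y‖ ≤ 1) {N : ℕ} {ε : ℝ} (hε0 : 0 ≤ ε)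
    (hε : ∀ y ∈ Omega, ‖H z y - partialSum s N z y‖ ≤ ε) (x : ℝ × ℝ) :
    ‖Tcal (s + 1) H z x - partialSum s (N + 1) z x‖ ≤
      Real.exp (-1) * ε + Real.exp (-1) * Real.exp (-1) ^ N := by
  refine le_of_tendsto ((tendsto_Tcal s hH1 x).sub_const _).norm ?_
  filter_upwards [eventually_gt_atTop N] with D hD
  have h1 := norm_partialSum_error_le hs hD hz x
  refine (norm_sub_le_norm_sub_add_norm_sub _ _ _).trans (add_le_add ?_ h1)
  rw [← mul_sub, ← Finset.sum_sub_distrib, norm_mul]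
  have hterm : ∀ d, ‖Tterm (s + 1) H z x d - (degWeight s d : ℂ) *
      (∫ y : Fin d → ℝ × ℝ,
        (starWeight d x y : ℂ) * ∏ k : Fin d × Fin s, partialSum s N z (y k.1)
        ∂(Measure.pi fun _ => nu))‖ ≤ degWeight s d * ((d * s : ℕ) : ℝ) * ε := by
    intro d
    rw [Tterm_succ_eq, ← mul_sub, norm_mul, Complex.norm_real, Real.norm_eq_abs,
      abs_of_nonneg (degWeight_nonneg s d), mul_assoc]
    exact mul_le_mul_of_nonneg_left (norm_integral_star_sub_le x hm hH1
      (measurable_partialSum s N z).aestronglyMeasurable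
      (fun y _ => norm_partialSum_le_one hs N (hz.trans exp_neg_two_le) y) hε)
      (degWeight_nonneg s d)
  calc _ ≤ Real.exp (-2) * ∑ d ∈ Finset.range D, degWeight s d * ((d * s : ℕ) : ℝ) * ε :=
        mul_le_mul hz ((norm_sum_le _ _).trans (Finset.sum_le_sum fun d _ => hterm d))
          (norm_nonneg _) (Real.exp_pos _).le
    _ ≤ Real.exp (-2) * (Real.exp 1 * ε) := by
        rw [← Finset.sum_mul]
        gcongr
        exact sum_degWeight_mul_le s D
    _ = Real.exp (-1) * ε := by
        rw [← mul_assoc, ← Real.exp_add]; norm_num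

lemma IsCCG.norm_sub_partialSum_le {s : ℕ} (hs : 1 ≤ s) {H : ℂ → ℝ × ℝ → ℂ}
    (hH : IsCCG (s + 1) H) {z : ℂ} (hz : z ∈ De) (N : ℕ) :
    ∀ x ∈ Omega, ‖H z x - partialSum s N z x‖ ≤ (N + 1) * Real.exp (-1) ^ N := by
  have hz' : ‖z‖ ≤ Real.exp (-2) := by simpa [De] using hz
  have hm : AEStronglyMeasurable (H z) nu := by
    have hc : ContinuousOn (H z) Omega :=
      hH.1.1.comp (f := fun x => (z, x)) (by fun_prop) fun x hx => ⟨hz, hx⟩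
    have := hc.aestronglyMeasurable (μ := nu) measurableSet_Omega
    rwa [nu_restrict] at this
  induction N with
  | zero => intro x hx; simpa [partialSum, coeff_zero] using hH.1.2 z hz x hx
  | succ N ih =>
    intro x hx
    rw [hH.2 z hz x hx]
    refine (norm_sub_partialSum_succ_le hs hz' hm (hH.1.2 z hz) (by positivity) ih x).trans
      (le_of_eq ?_)
    push_cast
    ring

lemma summable_coeff {s : ℕ} (hs : 1 ≤ s) {z : ℂ} (hz : ‖z‖ ≤ Real.exp (-2)) (x : ℝ × ℝ) :
    Summable fun n => (coeff s n x : ℂ) * z ^ n := by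
  refine Summable.of_norm_bounded (g := fun n => coeffSup s n * Real.exp (-1) ^ n) ?_ fun n => ?_
  · refine summable_of_sum_range_le (c := 1)
      (fun n => mul_nonneg (coeffSup_nonneg s n) (by positivity)) fun n => ?_
    refine le_trans (Finset.sum_le_sum_of_subset_of_nonneg (Finset.range_mono n.le_succ)
      fun n _ _ => mul_nonneg (coeffSup_nonneg s n) (by positivity)) (sum_coeffSup_le_one hs n)
  · rw [norm_mul, norm_pow, Complex.norm_real, Real.norm_eq_abs]
    exact mul_le_mul (abs_coeff_le s n x)
      (pow_le_pow_left₀ (norm_nonneg _) (hz.trans exp_neg_two_le) n) (by positivity)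
      (coeffSup_nonneg s n)

lemma IsCCG.eq_tsum_coeff {s : ℕ} (hs : 1 ≤ s) {H : ℂ → ℝ × ℝ → ℂ} (hH : IsCCG (s + 1) H)
    {z : ℂ} (hz : z ∈ De) {x : ℝ × ℝ} (hx : x ∈ Omega) :
    H z x = ∑' n, (coeff s (n + 1) x : ℂ) * z ^ (n + 1) := by
  have hsum := summable_coeff hs (by simpa [De] using hz) x
  have h1 : Tendsto (fun N => partialSum s N z x) atTop
      (nhds (∑' n, (coeff s n x : ℂ) * z ^ n)) :=
    hsum.hasSum.tendsto_sum_nat.comp (tendsto_add_atTop_nat 1)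
  have h2 : Tendsto (fun N => partialSum s N z x) atTop (nhds (H z x)) := by
    rw [tendsto_iff_norm_sub_tendsto_zero]
    have hr : Real.exp (-1) < 1 := Real.exp_lt_one_iff.2 (by norm_num)
    have h3 := (tendsto_self_mul_const_pow_of_lt_one (Real.exp_pos (-1)).le hr).add
      (tendsto_pow_atTop_nhds_zero_of_lt_one (Real.exp_pos (-1)).le hr)
    rw [add_zero] at h3
    refine squeeze_zero (fun _ => norm_nonneg _) (fun N => ?_) h3
    rw [norm_sub_rev]
    refine (hH.norm_sub_partialSum_le hs hz N x hx).trans (le_of_eq ?_)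
    ring
  rw [tendsto_nhds_unique h2 h1, hsum.tsum_eq_zero_add, coeff_zero]
  simp

/-- The Chord-Cavity-Generator has the tree expansion
`H(z,x) = Σ_{v≥1} (z^v/v!) Σ_{T ∈ 𝒯_v} Σ_{r ∈ V(T)} b_{T,r}(x)` on the domain. -/
theorem CCG_tree_expansion (q : ℕ) (hq : Even q) (hq2 : 2 ≤ q)
    (H : ℂ → ℝ × ℝ → ℂ) (hH : IsCCG q H) :
    ∀ z ∈ De, ∀ x ∈ Omega,
      H z x = ∑' v : ℕ, (z ^ (v + 1) / ((v + 1).factorial : ℂ)) *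
        ∑ E ∈ trees q (v + 1), ∑ r : Fin (v + 1), (bTr E r x : ℂ) := by
  intro z hz x hx
  obtain ⟨s, rfl⟩ : ∃ s, q = s + 1 := ⟨q - 1, by omega⟩
  rw [hH.eq_tsum_coeff (by omega) hz hx]
  refine tsum_congr fun n => ?_
  rw [trees_eq_treesOn, coeff, rootedSum]
  push_cast
  ring

end SYK
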